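/- arXiv:2304.01824 — 4 statements merged into one kernel-verified Lean document; each statement's English description precedes it below -/
import Mathlib

section
/- (Uniqueness of the partition function, rational case.) Let ν_1,…,ν_N ∈ ℂ be pairwise distinct and satisfy ν_j − ν_k ≠ 1 for all j ≠ k. Suppose P ∈ ℂ[λ_1,…,λ_N] is a polynomial such that: (1) P is symmetric in λ_1,…,λ_N; (2) P has degree at most N−1 in each λ_j; (3) P(ν_j, ν_j − 1, λ_3,…,λ_N) = 0 for every j = 1,…,N and all λ_3,…,λ_N ∈ ℂ; (4) P(ν_1,…,ν_N) = ∏_{j,k=1}^N (ν_j − ν_k + 1). Then P(λ_1,…,λ_N) = Z_N(λ_1,…,λ_N) for all λ_1,…,λ_N ∈ ℂ. In particular, any two polynomials with properties (1)–(4) coincide. -/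
open scoped BigOperators
noncomputable section

namespace SixVertex

/-- A spin configuration of the `N`-site quantum chain: one spin (`0` = up, `1` = down)
at each site. Site `k` of the paper (k = 1,…,N) corresponds to index `k-1 : Fin N`. -/
abbrev Cfg (N : ℕ) := Fin N → Fin 2

/-- Operators on the quantum space `H = (ℂ²)^{⊗N}`, represented as matrices in the
standard (spin-configuration) basis. -/
abbrev Op (N : ℕ) := Matrix (Cfg N) (Cfg N) ℂ

/-- The operator acting as the 2×2 matrix `M` in the `k`-th tensor factor and as the
identity elsewhere. -/
def siteOp {N : ℕ} (k : Fin N) (M : Matrix (Fin 2) (Fin 2) ℂ) : Op N :=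
  Matrix.of fun s s' => if ∀ i, i ≠ k → s i = s' i then M (s k) (s' k) else 0

def piPlus : Matrix (Fin 2) (Fin 2) ℂ := !![1, 0; 0, 0]
def piMinus : Matrix (Fin 2) (Fin 2) ℂ := !![0, 0; 0, 1]
def sigmaPlus : Matrix (Fin 2) (Fin 2) ℂ := !![0, 1; 0, 0]
def sigmaMinus : Matrix (Fin 2) (Fin 2) ℂ := !![0, 0; 1, 0]

/-- Rational weight `a(λ,ν) = λ - ν + 1`. -/
def aW (l v : ℂ) : ℂ := l - v + 1
/-- Rational weight `b(λ,ν) = λ - ν`. -/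
def bW (l v : ℂ) : ℂ := l - v

/-- The L-operator at site `k` (a 2×2 matrix in the auxiliary space, with entries
operators on the quantum space); the weight `c` equals `1`. -/
def Lop {N : ℕ} (ν : Fin N → ℂ) (k : Fin N) (l : ℂ) :
    Matrix (Fin 2) (Fin 2) (Op N) :=
  !![aW l (ν k) • siteOp k piPlus + bW l (ν k) • siteOp k piMinus,
       siteOp k sigmaMinus;
     siteOp k sigmaPlus,
       bW l (ν k) • siteOp k piPlus + aW l (ν k) • siteOp k piMinus]

/-- The monodromy matrix `T(λ) = L_N(λ,ν_N) ⋯ L_1(λ,ν_1)`. -/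
def monodromy {N : ℕ} (ν : Fin N → ℂ) (l : ℂ) :
    Matrix (Fin 2) (Fin 2) (Op N) :=
  (((List.finRange N).reverse).map fun k => Lop ν k l).prod

/-- The operator `A(λ)`. -/
def Aop {N : ℕ} (ν : Fin N → ℂ) (l : ℂ) : Op N := monodromy ν l 0 0
/-- The operator `B(λ)`. -/
def Bop {N : ℕ} (ν : Fin N → ℂ) (l : ℂ) : Op N := monodromy ν l 0 1
/-- The operator `C(λ)`. -/
def Cop {N : ℕ} (ν : Fin N → ℂ) (l : ℂ) : Op N := monodromy ν l 1 0
/-- The operator `D(λ)`. -/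
def Dop {N : ℕ} (ν : Fin N → ℂ) (l : ℂ) : Op N := monodromy ν l 1 1

/-- The all-spins-up configuration. -/
def upCfg (N : ℕ) : Cfg N := fun _ => 0
/-- The all-spins-down configuration. -/
def downCfg (N : ℕ) : Cfg N := fun _ => 1

/-- The basis vector of `H` corresponding to a spin configuration `s`. -/
def basisVec {N : ℕ} (s : Cfg N) : Cfg N → ℂ := Pi.single s 1

/-- The all-spins-up vacuum vector `|⇑⟩`. -/
def upVec (N : ℕ) : Cfg N → ℂ := basisVec (upCfg N)
/-- The all-spins-down vector `|⇓⟩`. -/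
def downVec (N : ℕ) : Cfg N → ℂ := basisVec (downCfg N)

/-- The partition function of the six-vertex model with domain wall boundary conditions:
`Z_N(λ_1,…,λ_N) = ⟨⇓| B(λ_N) ⋯ B(λ_1) |⇑⟩`. -/
def Zfun (N : ℕ) (ν : Fin N → ℂ) (lam : Fin N → ℂ) : ℂ :=
  (((List.finRange N).reverse).map fun j => Bop ν (lam j)).prod (downCfg N) (upCfg N)

end SixVertex
end

open SixVertex

namespace ZAux

/-- Local vertex weight, as a 2×2 matrix in the auxiliary space. -/
def Mloc (l v : ℂ) (s s' : Fin 2) : Matrix (Fin 2) (Fin 2) ℂ :=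
  Matrix.of fun α β => (l - v) * (if α = β ∧ s = s' then 1 else 0) +
    (if α = s' ∧ s = β then 1 else 0)

def Tloc {N : ℕ} (ν : Fin N → ℂ) (l : ℂ) (s s' : Cfg N) : Matrix (Fin 2) (Fin 2) ℂ :=
  (((List.finRange N).reverse).map fun k => Mloc l (ν k) (s k) (s' k)).prod

theorem Lop_apply {N : ℕ} (ν : Fin N → ℂ) (k : Fin N) (l : ℂ) (α γ : Fin 2) (s t : Cfg N) :
    Lop ν k l α γ s t = if ∀ i, i ≠ k → s i = t i then Mloc l (ν k) (s k) (t k) α γ else 0 := by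
  by_cases h : ∀ i, i ≠ k → s i = t i
  · rw [if_pos h]
    generalize hs : s k = a
    generalize ht : t k = b
    fin_cases α <;> fin_cases γ <;> fin_cases a <;> fin_cases b <;>
      simp [Lop, siteOp, Mloc, piPlus, piMinus, sigmaPlus, sigmaMinus, aW, bW, if_pos h] <;>
      simp_all
  · rw [if_neg h]
    fin_cases α <;> fin_cases γ <;> simp [Lop, siteOp, if_neg h]

theorem Lop_prod {N : ℕ} (ν : Fin N → ℂ) (l : ℂ) (L : List (Fin N)) (hL : L.Nodup) :
    ∀ (α β : Fin 2) (s s' : Cfg N),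
    (L.map fun k => Lop ν k l).prod α β s s' =
      if ∀ i, i ∉ L → s i = s' i then
        (L.map fun k => Mloc l (ν k) (s k) (s' k)).prod α β else 0 := by
  induction L with
  | nil =>
    intro α β s s'
    by_cases h : s = s'
    · subst h
      by_cases h2 : α = β <;> simp [Matrix.one_apply, h2]
    · have h' : ¬ ∀ i, s i = s' i := fun h2 => h (funext h2)
      by_cases h2 : α = β <;> simp [Matrix.one_apply, h2, h, h']
  | cons k L ih =>
    intro α β s s'
    have hk : k ∉ L := (List.nodup_cons.1 hL).1
    have ih := ih (List.nodup_cons.1 hL).2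
    rw [List.map_cons, List.prod_cons, List.map_cons, List.prod_cons, Matrix.mul_apply,
      Matrix.sum_apply]
    simp only [Matrix.mul_apply]
    have key : ∀ γ : Fin 2, ∑ t, Lop ν k l α γ s t * (L.map fun k => Lop ν k l).prod γ β t s'
        = if ∀ i, i ∉ k :: L → s i = s' i then Mloc l (ν k) (s k) (s' k) α γ *
          (L.map fun k => Mloc l (ν k) (s k) (s' k)).prod γ β else 0 := by
      intro γ
      rw [Finset.sum_eq_single (Function.update s k (s' k))]
      · rw [Lop_apply, ih, if_pos]
        · have e : (∀ i, i ∉ L → Function.update s k (s' k) i = s' i) ↔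
              ∀ i, i ∉ k :: L → s i = s' i := by
            constructor
            · intro h i hi
              have := h i (by simp_all)
              rwa [Function.update_of_ne (by simp_all)] at this
            · intro h i hi
              by_cases hik : i = k
              · subst hik; simp
              · rw [Function.update_of_ne hik]; exact h i (by simp_all)
          simp only [e]
          split_ifs
          · have : (L.map fun j => Mloc l (ν j) (Function.update s k (s' k) j) (s' j))
                = L.map fun j => Mloc l (ν j) (s j) (s' j) := by
              apply List.map_congr_left
              intro j hj
              rw [Function.update_of_ne (by rintro rfl; exact hk hj)]
            rw [this]; simp
          · simp
        · intro i hi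
          rw [Function.update_of_ne hi]
      · intro t _ ht
        rw [Lop_apply, ih]
        by_cases h1 : ∀ i, i ≠ k → s i = t i
        · by_cases h2 : ∀ i, i ∉ L → t i = s' i
          · exfalso; apply ht
            funext i
            by_cases hik : i = k
            · subst hik; simp [h2 i hk]
            · rw [Function.update_of_ne hik, h1 i hik]
          · rw [if_neg h2, mul_zero]
        · rw [if_neg h1, zero_mul]
      · simp
    simp only [key]
    split_ifs <;> simp

theorem Bop_apply {N : ℕ} (ν : Fin N → ℂ) (l : ℂ) (s s' : Cfg N) :
    Bop ν l s s' = Tloc ν l s s' 0 1 := by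
  rw [Bop, monodromy, Lop_prod _ _ _ (List.nodup_reverse.2 (List.nodup_finRange N)), if_pos, Tloc]
  intro i hi; simp at hi

theorem Tloc_succ {n : ℕ} (ν : Fin (n+1) → ℂ) (l : ℂ) (s s' : Cfg (n+1)) :
    Tloc ν l s s' = Tloc (fun i => ν i.succ) l (fun i => s i.succ) (fun i => s' i.succ) *
      Mloc l (ν 0) (s 0) (s' 0) := by
  simp [Tloc, List.finRange_succ, List.map_reverse, Function.comp_def]

/-! ### Exchange relation -/

theorem Mloc_exch (l v w : ℂ) (a b a' b' : Fin 2) :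
    (v - w) • (Mloc l w a b' * Mloc l v b a') + Mloc l w b b' * Mloc l v a a'
    = (v - w) • (Mloc l v b a' * Mloc l w a b') + Mloc l v b b' * Mloc l w a a' := by
  ext α β
  fin_cases α <;> fin_cases β <;> fin_cases a <;> fin_cases b <;> fin_cases a' <;> fin_cases b' <;>
   simp [Mloc, Matrix.mul_apply, Fin.sum_univ_two, -mul_eq_mul_left_iff] <;> ring

theorem Tloc_exch (n : ℕ) : ∀ (i : Fin n) (ν : Fin (n+1) → ℂ) (l : ℂ) (s s' : Cfg (n+1)),
    (ν i.castSucc - ν i.succ) • Tloc ν l (s ∘ Equiv.swap i.castSucc i.succ) s' + Tloc ν l s s'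
    = (ν i.castSucc - ν i.succ) • Tloc (ν ∘ Equiv.swap i.castSucc i.succ) l s
        (s' ∘ Equiv.swap i.castSucc i.succ) +
      Tloc (ν ∘ Equiv.swap i.castSucc i.succ) l s s' := by
  induction n with
  | zero => intro i; exact i.elim0
  | succ n ih =>
    intro i ν l s s'
    refine Fin.cases ?_ (fun j => ?_) i
    · simp only [Tloc_succ, Function.comp]
      have h : ∀ k : Fin n, Equiv.swap (0 : Fin (n+2)) 1 k.succ.succ = k.succ.succ := by
        intro k
        apply Equiv.swap_apply_of_ne_of_ne
        · exact Fin.succ_ne_zero _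
        · intro h; rw [← Fin.succ_zero_eq_one, Fin.succ_inj] at h; exact Fin.succ_ne_zero _ h
      simp only [Fin.castSucc_zero, Fin.succ_zero_eq_one, h, Equiv.swap_apply_left,
        Equiv.swap_apply_right, Matrix.mul_assoc]
      have hM := congrArg (fun M => Tloc (fun i : Fin n => ν i.succ.succ) l (fun i => s i.succ.succ)
        (fun i => s' i.succ.succ) * M) (Mloc_exch l (ν 0) (ν 1) (s 0) (s 1) (s' 0) (s' 1))
      simpa only [Matrix.mul_add, Matrix.mul_smul] using hM
    · have h0 : Equiv.swap j.succ.castSucc j.succ.succ 0 = 0 := by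
        apply Equiv.swap_apply_of_ne_of_ne
        · rw [← Fin.succ_castSucc]; exact (Fin.succ_ne_zero _).symm
        · exact (Fin.succ_ne_zero _).symm
      have hs : ∀ k : Fin (n+1), Equiv.swap j.succ.castSucc j.succ.succ k.succ =
          (Equiv.swap j.castSucc j.succ k).succ := by
        intro k
        rw [← Fin.succ_castSucc]
        simp only [Equiv.swap_apply_def, Fin.succ_inj]
        split_ifs <;> rfl
      have := ih j (fun i => ν i.succ) l (fun i => s i.succ) (fun i => s' i.succ)
      simp only [Function.comp_def] at this
      rw [Tloc_succ ν, Tloc_succ ν, Tloc_succ (ν ∘ _), Tloc_succ (ν ∘ _)]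
      simp only [Function.comp, h0, hs]
      rw [← Matrix.smul_mul, ← Matrix.smul_mul, ← Matrix.add_mul, ← Matrix.add_mul,
        ← Fin.succ_castSucc, this]

/-- intertwiner -/
def Xop {n : ℕ} (u : ℂ) (w : Equiv.Perm (Fin n)) : Op n :=
  Matrix.of fun s s' => u * (if s' = s ∘ w then 1 else 0) + (if s' = s then 1 else 0)

theorem Xop_mul {n : ℕ} (u : ℂ) (w : Equiv.Perm (Fin n)) (A : Op n) (s s' : Cfg n) :
    (Xop u w * A) s s' = u * A (s ∘ w) s' + A s s' := by
  simp [Xop, Matrix.mul_apply, add_mul, Finset.sum_add_distrib]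

theorem mul_Xop {n : ℕ} (u : ℂ) (w : Equiv.Perm (Fin n)) (hw : ∀ i, w (w i) = i)
    (A : Op n) (s s' : Cfg n) :
    (A * Xop u w) s s' = u * A s (s' ∘ w) + A s s' := by
  have : ∀ x : Cfg n, s' = x ∘ w ↔ s' ∘ w = x := by
    intro x
    constructor
    · rintro rfl; funext i; simp [hw]
    · rintro rfl; funext i; simp [hw]
  simp [Xop, Matrix.mul_apply, mul_add, Finset.sum_add_distrib, this, mul_comm]

theorem Z_swap {n : ℕ} (i : Fin n) (ν : Fin (n+1) → ℂ) (lam : Fin (n+1) → ℂ)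
    (h : ν i.succ - ν i.castSucc ≠ 1) :
    Zfun (n+1) (ν ∘ Equiv.swap i.castSucc i.succ) lam = Zfun (n+1) ν lam := by
  set w := Equiv.swap i.castSucc i.succ with hwdef
  set u := ν i.castSucc - ν i.succ with hu
  have hw : ∀ i, w (w i) = i := by intro k; simp [hwdef]
  have hB : ∀ l, Xop u w * Bop ν l = Bop (ν ∘ w) l * Xop u w := by
    intro l
    ext s s'
    rw [Xop_mul, mul_Xop _ _ hw]
    simp only [Bop_apply]
    have := congrFun (congrFun (Tloc_exch n i ν l s s') 0) 1
    simpa using this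
  have hL : ∀ L : List (Fin (n+1)), Xop u w * (L.map fun j => Bop ν (lam j)).prod =
      (L.map fun j => Bop (ν ∘ w) (lam j)).prod * Xop u w := by
    intro L
    induction L with
    | nil => simp
    | cons a L ih =>
      simp only [List.map_cons, List.prod_cons]
      rw [← Matrix.mul_assoc, hB, Matrix.mul_assoc, ih, Matrix.mul_assoc]
  have := congrFun (congrFun (hL (List.finRange (n+1)).reverse) (downCfg _)) (upCfg _)
  rw [Xop_mul, mul_Xop _ _ hw] at this
  change u * Zfun (n+1) ν lam + Zfun (n+1) ν lam =
    u * Zfun (n+1) (ν ∘ w) lam + Zfun (n+1) (ν ∘ w) lam at this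
  have h1 : u + 1 ≠ 0 := by
    intro h1; apply h; rw [hu] at h1; linear_combination -h1
  apply mul_left_cancel₀ h1
  linear_combination -this

theorem Z_perm {N : ℕ} (σ : Equiv.Perm (Fin N)) : ∀ (ν : Fin N → ℂ) (lam : Fin N → ℂ),
    (∀ j k : Fin N, j ≠ k → ν j - ν k ≠ 1) →
    Zfun N (ν ∘ σ) lam = Zfun N ν lam := by
  cases N with
  | zero =>
    intro ν lam _
    congr 1
    funext i; exact i.elim0
  | succ n =>
    have hσ : σ ∈ Submonoid.closure (Set.range fun i : Fin n => Equiv.swap i.castSucc i.succ) := by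
      rw [Equiv.Perm.mclosure_swap_castSucc_succ]; trivial
    induction hσ using Submonoid.closure_induction with
    | mem x hx =>
      obtain ⟨i, rfl⟩ := hx
      intro ν lam h
      exact Z_swap i ν lam (h _ _ (Fin.castSucc_lt_succ).ne')
    | one => intro ν lam _; rfl
    | mul x y _ _ hx hy =>
      intro ν lam h
      rw [Equiv.Perm.coe_mul, ← Function.comp_assoc, hy, hx _ _ h]
      intro j k hjk
      exact h _ _ (fun h => hjk (x.injective h))

/-! ### Freezing recursion -/

theorem Tloc_up (n : ℕ) : ∀ (ν : Fin n → ℂ) (l : ℂ) (s : Cfg n),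
    Tloc ν l s (upCfg n) 0 0 = if s = upCfg n then ∏ i, (l - ν i + 1) else 0 := by
  induction n with
  | zero => intro ν l s; rw [if_pos (Subsingleton.elim _ _)]; simp [Tloc]
  | succ n ih =>
    intro ν l s
    rw [Tloc_succ, Matrix.mul_apply, Fin.sum_univ_two]
    have := ih (fun i => ν i.succ) l (fun i => s i.succ)
    unfold upCfg at this ⊢
    rw [this, Fin.prod_univ_succ]
    have e : (s = fun _ => 0) ↔ s 0 = 0 ∧ (fun i : Fin n => s i.succ) = fun _ => 0 := by
      simp only [funext_iff, Fin.forall_fin_succ]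
    simp only [e]
    generalize s 0 = a
    by_cases h : (fun i : Fin n => s i.succ) = fun _ => 0 <;> fin_cases a <;>
      simp [Mloc, h] <;> ring

theorem B_frozen {n : ℕ} (ν : Fin (n+1) → ℂ) (l : ℂ) (s : Cfg (n+1)) (t : Cfg n) :
    Bop ν l s (Fin.cons 1 t) = if s 0 = 1 then
      (l - ν 0 + 1) * Bop (fun i => ν i.succ) l (fun i => s i.succ) t else 0 := by
  rw [Bop_apply, Bop_apply, Tloc_succ, Matrix.mul_apply, Fin.sum_univ_two]
  simp only [Fin.cons_zero, Fin.cons_succ]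
  generalize s 0 = a
  fin_cases a <;> simp [Mloc]; ring

theorem sum_cfg {n : ℕ} (f : Cfg (n+1) → ℂ) :
    ∑ s, f s = ∑ t : Cfg n, f (Fin.cons 0 t) + ∑ t : Cfg n, f (Fin.cons 1 t) := by
  rw [← (Fin.consEquiv (fun _ : Fin (n+1) => Fin 2)).sum_comp, Fintype.sum_prod_type,
    Fin.sum_univ_two]
  rfl

theorem Bprod_frozen {n : ℕ} {ι : Type} (ν : Fin (n+1) → ℂ) (lam : ι → ℂ) (L : List ι) :
    ∀ (s : Cfg (n+1)) (t : Cfg n),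
    (L.map fun j => Bop ν (lam j)).prod s (Fin.cons 1 t) = if s 0 = 1 then
      (L.map fun j => lam j - ν 0 + 1).prod *
        (L.map fun j => Bop (fun i => ν i.succ) (lam j)).prod (fun i => s i.succ) t else 0 := by
  induction L with
  | nil =>
    intro s t
    have e : s = Fin.cons 1 t ↔ s 0 = 1 ∧ (fun i : Fin n => s i.succ) = t := by
      simp only [funext_iff, Fin.forall_fin_succ, Fin.cons_zero, Fin.cons_succ]
    simp only [List.map_nil, List.prod_nil, Matrix.one_apply, e]
    split_ifs <;> simp_all
  | cons a L ih =>
    intro s t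
    simp only [List.map_cons, List.prod_cons]
    rw [Matrix.mul_apply, sum_cfg, Matrix.mul_apply]
    simp only [ih, B_frozen, Fin.cons_zero, Fin.cons_succ]
    by_cases h : s 0 = 1
    · simp only [h, if_true, zero_ne_one, if_false, mul_zero, Finset.sum_const_zero, zero_add]
      rw [Finset.mul_sum]
      refine Finset.sum_congr rfl fun x _ => ?_
      ring
    · simp [h]

theorem Z_rec {n : ℕ} (ν lam : Fin (n+1) → ℂ) (h : lam 0 = ν 0) :
    Zfun (n+1) ν lam = (∏ i : Fin n, (ν 0 - ν i.succ + 1)) * (∏ j : Fin n, (lam j.succ - ν 0 + 1)) *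
      Zfun n (fun i => ν i.succ) (fun i => lam i.succ) := by
  unfold Zfun
  have hd : (fun i : Fin n => downCfg (n+1) i.succ) = downCfg n := rfl
  have hB : ∀ s, Bop ν (lam 0) s (upCfg (n+1)) =
      if s = Fin.cons 1 (upCfg n) then ∏ i : Fin n, (ν 0 - ν i.succ + 1) else 0 := by
    intro s
    have e : s = Fin.cons 1 (upCfg n) ↔ s 0 = 1 ∧ (fun i : Fin n => s i.succ) = upCfg n := by
      simp only [funext_iff, Fin.forall_fin_succ, Fin.cons_zero, Fin.cons_succ]
    rw [Bop_apply, Tloc_succ, Matrix.mul_apply, Fin.sum_univ_two]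
    have := Tloc_up n (fun i => ν i.succ) (lam 0) (fun i => s i.succ)
    have h2 : (fun i : Fin n => upCfg (n+1) i.succ) = upCfg n := rfl
    rw [h2, this, h]
    simp only [e]
    have h3 : upCfg (n+1) 0 = 0 := rfl
    rw [h3]
    generalize s 0 = a
    fin_cases a <;> simp [Mloc]
  rw [List.finRange_succ, List.reverse_cons, List.map_append, List.prod_append, List.map_singleton,
    List.prod_singleton, Matrix.mul_apply]
  simp only [hB, mul_ite, mul_zero, Finset.sum_ite_eq', Finset.mem_univ, if_true]
  rw [← List.map_reverse, List.map_map]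
  have := Bprod_frozen ν (fun j : Fin n => lam j.succ) (List.finRange n).reverse (downCfg (n+1))
    (upCfg n)
  rw [if_pos (show downCfg (n+1) 0 = 1 from rfl), hd] at this
  change (List.map (fun j : Fin n => Bop ν (lam j.succ)) _).prod _ _ * _ = _
  rw [this]
  have h5 : ((List.finRange n).reverse.map fun j => lam j.succ - ν 0 + 1).prod =
      ∏ j : Fin n, (lam j.succ - ν 0 + 1) := by
    rw [List.map_reverse, List.prod_reverse, ← List.ofFn_eq_map, List.prod_ofFn]
  rw [h5]; ring

theorem Z_val (n : ℕ) : ∀ ν : Fin n → ℂ, Zfun n ν ν = ∏ j, ∏ k, (ν j - ν k + 1) := by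
  induction n with
  | zero => intro ν; simp [Zfun, Matrix.one_apply]; exact Subsingleton.elim _ _
  | succ n ih =>
    intro ν
    rw [Z_rec ν ν rfl, ih]
    simp only [Fin.prod_univ_succ, Finset.prod_mul_distrib]
    simp; ring

theorem Z_van (n : ℕ) : ∀ (ν lam : Fin n → ℂ) (r i : Fin n), i < r →
    (∀ k, k < r → lam k = ν k) → lam r = ν i - 1 → Zfun n ν lam = 0 := by
  induction n with
  | zero => intro ν lam r; exact r.elim0
  | succ n ih =>
    intro ν lam r i hir hk hr
    obtain ⟨r', rfl⟩ := Fin.exists_succ_eq.2 (Fin.pos_iff_ne_zero.1 (lt_of_le_of_lt (Fin.zero_le i) hir))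
    rw [Z_rec ν lam (hk 0 (Fin.succ_pos _))]
    rcases Fin.eq_zero_or_eq_succ i with rfl | ⟨i', rfl⟩
    · have : ∏ j : Fin n, (lam j.succ - ν 0 + 1) = 0 :=
        Finset.prod_eq_zero (Finset.mem_univ r') (by rw [hr]; ring)
      rw [this]; simp
    · rw [ih _ _ r' i' (Fin.succ_lt_succ_iff.1 hir) _ hr, mul_zero]
      intro k hkr
      exact hk _ (Fin.succ_lt_succ_iff.2 hkr)

/-! ### Polynomial degree -/

def PD (n : ℕ) (f : ℂ → ℂ) : Prop := ∃ p : Polynomial ℂ, p.degree < n ∧ ∀ x, p.eval x = f x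

theorem PD.add {n : ℕ} {f g : ℂ → ℂ} (hf : PD n f) (hg : PD n g) : PD n (fun x => f x + g x) := by
  obtain ⟨p, hp, hp'⟩ := hf
  obtain ⟨q, hq, hq'⟩ := hg
  exact ⟨p + q, lt_of_le_of_lt (Polynomial.degree_add_le _ _) (max_lt hp hq), by simp [hp', hq']⟩

theorem PD.zero (n : ℕ) : PD n (fun _ => 0) :=
  ⟨0, by simp [Polynomial.degree_zero], by simp⟩

theorem PD.cmul {n : ℕ} {f : ℂ → ℂ} (c : ℂ) (hf : PD n f) : PD n (fun x => c * f x) := by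
  obtain ⟨p, hp, hp'⟩ := hf
  refine ⟨c • p, lt_of_le_of_lt (Polynomial.degree_smul_le _ _) hp, by simp [hp']⟩

theorem PD.mono {n m : ℕ} (h : n ≤ m) {f : ℂ → ℂ} (hf : PD n f) : PD m f := by
  obtain ⟨p, hp, hp'⟩ := hf
  exact ⟨p, lt_of_lt_of_le hp (by exact_mod_cast h), hp'⟩

theorem PD.lin {n : ℕ} {f : ℂ → ℂ} (c : ℂ) (hf : PD n f) : PD (n+1) (fun x => f x * (x - c)) := by
  obtain ⟨p, hp, hp'⟩ := hf
  refine ⟨p * (Polynomial.X - Polynomial.C c), ?_, by simp [hp']⟩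
  rw [Polynomial.degree_mul, Polynomial.degree_X_sub_C]
  by_cases h0 : p = 0
  · subst h0; simp [Polynomial.degree_zero]
  · rw [Polynomial.degree_eq_natDegree h0] at hp ⊢
    have : p.natDegree < n := by exact_mod_cast hp
    exact_mod_cast Nat.succ_lt_succ this

theorem PD.pow {n k : ℕ} (h : k < n) : PD n (fun x => x ^ k) :=
  ⟨Polynomial.X ^ k, by rw [Polynomial.degree_X_pow]; exact_mod_cast h, by simp⟩

theorem PD.sum {n : ℕ} {ι : Type*} (s : Finset ι) (f : ι → ℂ → ℂ) (h : ∀ i ∈ s, PD n (f i)) :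
    PD n (fun x => ∑ i ∈ s, f i x) := by
  classical
  induction s using Finset.induction_on with
  | empty => simpa using PD.zero n
  | insert a s ha ih =>
    simp only [Finset.sum_insert ha]
    exact (h a (by simp)).add (ih fun i hi => h i (by simp [hi]))

theorem Tloc_PD (n : ℕ) : ∀ (ν : Fin n → ℂ) (s s' : Cfg n) (α β : Fin 2),
    PD (if α = β then n + 1 else n) (fun l => Tloc ν l s s' α β) := by
  induction n with
  | zero =>
    intro ν s s' α β
    by_cases h : α = β
    · simp only [Tloc, h]
      simpa using PD.pow (n := 1) (k := 0) (by norm_num)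
    · simpa [Tloc, h, Matrix.one_apply] using PD.zero 0
  | succ n ih =>
    intro ν s s' α β
    simp only [Tloc_succ, Matrix.mul_apply]
    apply PD.sum
    intro γ _
    have h := ih (fun i => ν i.succ) (fun i => s i.succ) (fun i => s' i.succ) α γ
    simp only [Mloc, Matrix.of_apply, mul_add]
    apply PD.add
    · by_cases h1 : γ = β ∧ s 0 = s' 0
      · simp only [if_pos h1, mul_one]
        rw [h1.1] at h ⊢
        have := h.lin (ν 0)
        refine this.mono ?_
        split_ifs <;> omega
      · simp only [if_neg h1, mul_zero]
        exact PD.zero _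
    · have h2 := h.cmul (if γ = s' 0 ∧ s 0 = β then 1 else 0)
      simp only [mul_comm] at h2 ⊢
      refine h2.mono ?_
      split_ifs <;> omega

theorem B_PD {N : ℕ} (ν : Fin N → ℂ) (s s' : Cfg N) : PD N (fun l => Bop ν l s s') := by
  simp only [Bop_apply]
  simpa using Tloc_PD N ν s s' 0 1

theorem Z_PD {N : ℕ} (ν lam : Fin N → ℂ) (r : Fin N) :
    PD N (fun x => Zfun N ν (Function.update lam r x)) := by
  have hr : r ∈ (List.finRange N).reverse := by simp
  have hnd : (List.finRange N).reverse.Nodup := List.nodup_reverse.2 (List.nodup_finRange N)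
  obtain ⟨L₁, L₂, hL⟩ := List.append_of_mem hr
  unfold Zfun
  rw [hL] at hnd ⊢
  have h1 : r ∉ L₁ := by
    intro h; exact (List.disjoint_of_nodup_append hnd) h (by simp)
  have h2 : r ∉ L₂ := (List.nodup_cons.1 (List.Nodup.of_append_right hnd)).1
  have hc : ∀ L : List (Fin N), r ∉ L → ∀ x,
      (L.map fun j => Bop ν (Function.update lam r x j)) = L.map fun j => Bop ν (lam j) := by
    intro L hrL x
    apply List.map_congr_left
    intro j hj
    rw [Function.update_of_ne (by rintro rfl; exact hrL hj)]
  simp only [List.map_append, List.map_cons, List.prod_append, List.prod_cons, hc _ h1, hc _ h2,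
    Function.update_self, Matrix.mul_apply, Finset.mul_sum]
  apply PD.sum; intro s _
  apply PD.sum; intro t _
  apply PD.cmul
  have := (B_PD ν s t).cmul ((L₂.map fun j => Bop ν (lam j)).prod t (upCfg N))
  simpa only [mul_comm] using this

theorem P_PD {N : ℕ} (hN : 1 ≤ N) (P : MvPolynomial (Fin N) ℂ) (lam : Fin N → ℂ) (r : Fin N)
    (hdeg : P.degreeOf r ≤ N - 1) :
    PD N (fun x => MvPolynomial.eval (Function.update lam r x) P) := by
  simp only [MvPolynomial.eval_eq']
  apply PD.sum
  intro m hm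
  apply PD.cmul
  have hle := MvPolynomial.monomial_le_degreeOf r hm
  have h := (PD.pow (n := N) (k := m r) (by omega)).cmul (∏ i ∈ Finset.univ.erase r, lam i ^ m i)
  have e : ∀ x, ∏ i, Function.update lam r x i ^ m i =
      (∏ i ∈ Finset.univ.erase r, lam i ^ m i) * x ^ m r := by
    intro x
    rw [← Finset.mul_prod_erase _ _ (Finset.mem_univ r), Function.update_self, mul_comm]
    congr 1
    apply Finset.prod_congr rfl
    intro i hi
    rw [Function.update_of_ne (Finset.ne_of_mem_erase hi)]
  simpa only [e] using h

theorem PD_eq {N : ℕ} {f g : ℂ → ℂ} (hf : PD N f) (hg : PD N g) (v : Fin N → ℂ)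
    (hv : Function.Injective v) (h : ∀ i, f (v i) = g (v i)) (x : ℂ) : f x = g x := by
  obtain ⟨p, hp, hp'⟩ := hf
  obtain ⟨q, hq, hq'⟩ := hg
  have : p = q := by
    apply Polynomial.eq_of_degrees_lt_of_eval_index_eq (s := Finset.univ) (v := v)
      (hv.injOn)
    · simpa using hp
    · simpa using hq
    · intro i _; rw [hp', hq', h]
  rw [← hp', ← hq', this]

end ZAux

open SixVertex in
/-- uniqueness of the partition function, rational case: if `ν` are
pairwise distinct with `ν_j - ν_k ≠ 1` for `j ≠ k`, then any symmetric polynomial `P` in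
`λ_1,…,λ_N` of degree at most `N-1` in each variable, that vanishes whenever two of its
arguments equal `ν_j` and `ν_j - 1` (for some `j`), and with
`P(ν_1,…,ν_N) = ∏_{j,k=1}^N (ν_j - ν_k + 1)`, coincides with `Z_N`.
(Since `P` is symmetric, the vanishing condition is phrased via an arbitrary pair of
distinct argument slots carrying the values `ν_j` and `ν_j - 1`.) -/
theorem Zfun_unique (N : ℕ) (hN : 1 ≤ N) (ν : Fin N → ℂ)
    (hν : Function.Injective ν)
    (hν1 : ∀ j k : Fin N, j ≠ k → ν j - ν k ≠ 1)
    (P : MvPolynomial (Fin N) ℂ)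
    (hsym : P.IsSymmetric)
    (hdeg : ∀ j : Fin N, P.degreeOf j ≤ N - 1)
    (hvan : ∀ (j : Fin N) (lam : Fin N → ℂ) (i₁ i₂ : Fin N), i₁ ≠ i₂ →
      lam i₁ = ν j → lam i₂ = ν j - 1 → MvPolynomial.eval lam P = 0)
    (hval : MvPolynomial.eval ν P = ∏ j, ∏ k, (ν j - ν k + 1)) :
    ∀ lam : Fin N → ℂ, MvPolynomial.eval lam P = Zfun N ν lam := by
  suffices H : ∀ d r : ℕ, r + d = N → ∀ (σ : Equiv.Perm (Fin N)) (lam : Fin N → ℂ),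
      (∀ i : Fin N, (i : ℕ) < r → lam i = ν (σ i)) →
      MvPolynomial.eval lam P = Zfun N ν lam by
    intro lam
    exact H N 0 (by omega) 1 lam (fun i hi => absurd hi (by omega))
  intro d
  induction d with
  | zero =>
    intro r hr σ lam hlam
    have hl : lam = ν ∘ σ := funext fun i => hlam i (by have := i.2; omega)
    rw [← ZAux.Z_perm σ ν lam hν1, hl, ZAux.Z_val]
    have h1 : MvPolynomial.eval (ν ∘ σ) P = MvPolynomial.eval ν P := by
      rw [← MvPolynomial.eval_rename, hsym σ]
    rw [h1, hval]
    simp only [Function.comp]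
    rw [← Equiv.prod_comp σ (fun j => ∏ k, (ν j - ν k + 1))]
    refine Finset.prod_congr rfl fun j _ => ?_
    exact (Equiv.prod_comp σ (fun k => ν (σ j) - ν k + 1)).symm
  | succ d ih =>
    intro r hr σ lam hlam
    have hrN : r < N := by omega
    set R : Fin N := ⟨r, hrN⟩ with hR
    have key := ZAux.PD_eq (ZAux.P_PD hN P lam R (hdeg R)) (ZAux.Z_PD ν lam R)
      (fun m => if m < R then ν (σ m) - 1 else ν (σ m)) ?_ ?_ (lam R)
    · simpa using key
    · intro a b hab
      simp only at hab
      by_cases hne : a = b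
      · exact hne
      exfalso
      have hσ : σ a ≠ σ b := fun h => hne (σ.injective h)
      have hs := hν1 _ _ hσ
      have hs' := hν1 _ _ hσ.symm
      have hn : ν (σ a) ≠ ν (σ b) := fun h => hσ (hν h)
      split_ifs at hab
      · exact hn (by linear_combination hab)
      · exact hs (by linear_combination hab)
      · exact hs' (by linear_combination -hab)
      · exact hn hab
    · intro m
      have hlt : ∀ (x : ℂ) (i : Fin N), i < R → Function.update lam R x i = ν (σ i) := by
        intro x i hi
        rw [Function.update_of_ne hi.ne]
        exact hlam i hi
      by_cases hm : m < R
      · simp only [if_pos hm]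
        rw [hvan (σ m) _ m R hm.ne (hlt _ m hm) (Function.update_self _ _ _),
          ← ZAux.Z_perm σ ν _ hν1]
        exact (ZAux.Z_van N (ν ∘ σ) _ R m hm (fun k hk => hlt _ k hk)
          (Function.update_self _ _ _)).symm
      · simp only [if_neg hm]
        apply ih (r + 1) (by omega) (σ * Equiv.swap R m)
        intro i hi
        rw [Equiv.Perm.mul_apply]
        by_cases hiR : i = R
        · subst hiR
          rw [Function.update_self, Equiv.swap_apply_left]
        · have hi' : i < R := by
            refine lt_of_le_of_ne ?_ hiR
            exact Nat.lt_succ_iff.1 hi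
          rw [hlt _ i hi', Equiv.swap_apply_of_ne_of_ne hiR]
          rintro rfl; exact hm hi'
end

section
/- (Determinant representation, rational case.) Let ν_1,…,ν_N ∈ ℂ be pairwise distinct with ν_j − ν_k ≠ 1 for all j ≠ k, and set a(λ) = ∏_{k=1}^N (λ − ν_k + 1), d(λ) = ∏_{k=1}^N (λ − ν_k). Let p_1,…,p_N ∈ ℂ[λ] be polynomials of degree at most N−1 whose N×N coefficient matrix [p_{ij}] (where p_i(λ) = Σ_{j=1}^N p_{ij} λ^{j−1}) is invertible. Then for all λ_1,…,λ_N ∈ ℂ: Z_N(λ_1,…,λ_N) · det[ p_k(λ_j) ]_{j,k=1,…,N} = det[ p_k(λ_j) a(λ_j) − p_k(λ_j + 1) d(λ_j) ]_{j,k=1,…,N}. -/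
open scoped BigOperators
namespace SixVertex

/-- The polynomial `p_i(x) = ∑_{j=1}^N p_{ij} x^{j-1}` of degree at most `N-1`,
determined by the row `i` of a coefficient matrix `p`. -/
noncomputable def pval {N : ℕ} (p : Matrix (Fin N) (Fin N) ℂ) (i : Fin N) (x : ℂ) : ℂ :=
  ∑ j, p i j * x ^ (j : ℕ)

end SixVertex

namespace SixVertex

/-- The scalar L-operator: entry `(i,m)` of the auxiliary space, as a 2×2 matrix on the site. -/
noncomputable def Lsc (l v : ℂ) (i m : Fin 2) : Matrix (Fin 2) (Fin 2) ℂ :=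
  Matrix.of fun a b => (if i = m ∧ a = b then l - v else 0) + (if i = b ∧ m = a then 1 else 0)

lemma Lop_eq {N : ℕ} (ν : Fin N → ℂ) (k : Fin N) (l : ℂ) (i m : Fin 2) :
    Lop ν k l i m = siteOp k (Lsc l (ν k) i m) := by
  ext s s'
  by_cases h : ∀ i, i ≠ k → s i = s' i
  · generalize hs : s k = x
    generalize hs' : s' k = y
    fin_cases i <;> fin_cases m <;>
    simp [Lop, siteOp, h, hs, hs'] <;> fin_cases x <;> fin_cases y <;>
      simp [Lsc, piPlus, piMinus, sigmaPlus, sigmaMinus, aW, bW]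
  · fin_cases i <;> fin_cases m <;> simp [Lop, siteOp, h]

lemma Lsc_RTT (u w v : ℂ) (i k m n : Fin 2) :
    (u - w) • (Lsc u v i m * Lsc w v k n) + Lsc u v k m * Lsc w v i n =
    (u - w) • (Lsc w v k n * Lsc u v i m) + Lsc w v k m * Lsc u v i n := by
  ext a b
  simp only [Matrix.add_apply, Matrix.smul_apply, Matrix.mul_apply, Fin.sum_univ_two, Lsc,
    Matrix.of_apply, smul_eq_mul]
  fin_cases i <;> fin_cases k <;> fin_cases m <;> fin_cases n <;> fin_cases a <;> fin_cases b <;>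
    simp <;> first | ring1 | (left; ring1)

/-- The block of an operator on `N+1` sites with respect to the last site. -/
noncomputable def blk {N : ℕ} (a b : Fin 2) (M : Op (N + 1)) : Op N :=
  Matrix.of fun s s' => M (Fin.snoc (α := fun _ => Fin 2) s a) (Fin.snoc (α := fun _ => Fin 2) s' b)

lemma blk_ext {N : ℕ} {M M' : Op (N + 1)} (h : ∀ a b, blk a b M = blk a b M') : M = M' := by
  ext s s'
  have := congrFun (congrFun (h (s (Fin.last N)) (s' (Fin.last N))) (Fin.init s)) (Fin.init s')
  simpa [blk] using this

lemma blk_add {N : ℕ} (a b : Fin 2) (M M' : Op (N + 1)) :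
    blk a b (M + M') = blk a b M + blk a b M' := rfl

lemma blk_smul {N : ℕ} (a b : Fin 2) (c : ℂ) (M : Op (N + 1)) :
    blk a b (c • M) = c • blk a b M := rfl

lemma blk_sum {N : ℕ} (a b : Fin 2) {ι : Type*} (t : Finset ι) (M : ι → Op (N + 1)) :
    blk a b (∑ i ∈ t, M i) = ∑ i ∈ t, blk a b (M i) := by
  ext s s'
  simp [blk, Matrix.sum_apply]

lemma blk_mul {N : ℕ} (a b : Fin 2) (M M' : Op (N + 1)) :
    blk a b (M * M') = ∑ c, blk a c M * blk c b M' := by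
  ext s s'
  simp only [blk, Matrix.mul_apply, Matrix.of_apply, Matrix.sum_apply]
  rw [← (Fin.snocEquiv (fun _ : Fin (N + 1) => Fin 2)).sum_comp, Fintype.sum_prod_type]
  rfl

lemma blk_one {N : ℕ} (a b : Fin 2) :
    blk a b (1 : Op (N + 1)) = if a = b then 1 else 0 := by
  ext s s'
  by_cases h : a = b
  · subst h
    simp [blk, Matrix.one_apply, Fin.snoc_inj]
  · simp [blk, Fin.snoc_inj, h]

lemma blk_siteOp_last {N : ℕ} (a b : Fin 2) (M : Matrix (Fin 2) (Fin 2) ℂ) :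
    blk a b (siteOp (Fin.last N) M) = M a b • (1 : Op N) := by
  ext s s'
  simp [blk, siteOp, Matrix.one_apply, Fin.forall_fin_succ', funext_iff]

lemma blk_siteOp_castSucc {N : ℕ} (a b : Fin 2) (k : Fin N) (M : Matrix (Fin 2) (Fin 2) ℂ) :
    blk a b (siteOp k.castSucc M) = if a = b then siteOp k M else 0 := by
  ext s s'
  by_cases h : a = b
  · subst h
    simp [blk, siteOp, Fin.forall_fin_succ']
  · simp [blk, siteOp, Fin.forall_fin_succ', h, (Fin.castSucc_lt_last k).ne']

lemma blk_list {N : ℕ} (ν : Fin (N + 1) → ℂ) (l : ℂ) (L : List (Fin N)) (a b i j : Fin 2) :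
    blk a b ((L.map fun k => Lop ν k.castSucc l).prod i j) =
      if a = b then (L.map fun k => Lop (fun k => ν k.castSucc) k l).prod i j else 0 := by
  induction L generalizing a b i j with
  | nil =>
    by_cases h : i = j
    · subst h; simp [blk_one]
    · simp only [List.map_nil, List.prod_nil, Matrix.one_apply_ne h, ite_self]; rfl
  | cons k L ih =>
    simp only [List.map_cons, List.prod_cons, Matrix.mul_apply, blk_sum, blk_mul, ih, Lop_eq,
      blk_siteOp_castSucc]
    by_cases h : a = b
    · subst h; simp
    · simp [h]

lemma blk_monodromy {N : ℕ} (ν : Fin (N + 1) → ℂ) (l : ℂ) (a b i j : Fin 2) :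
    blk a b (monodromy ν l i j) =
      ∑ m, Lsc l (ν (Fin.last N)) i m a b • monodromy (fun k => ν k.castSucc) l m j := by
  have : monodromy ν l = Lop ν (Fin.last N) l *
      (((List.finRange N).reverse).map fun k => Lop ν k.castSucc l).prod := by
    simp [monodromy, List.finRange_succ_last, Function.comp_def]
  rw [this]
  simp only [Matrix.mul_apply, blk_sum, blk_mul, blk_list, Lop_eq, blk_siteOp_last]
  simp [monodromy]

lemma monodromy_RTT {N : ℕ} (ν : Fin N → ℂ) (u w : ℂ) (i j k l : Fin 2) :
    (u - w) • (monodromy ν u i j * monodromy ν w k l) + monodromy ν u k j * monodromy ν w i l =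
    (u - w) • (monodromy ν w k l * monodromy ν u i j) + monodromy ν w k j * monodromy ν u i l := by
  induction N generalizing i j k l with
  | zero =>
    simp only [monodromy, List.finRange_zero, List.reverse_nil, List.map_nil, List.prod_nil]
    fin_cases i <;> fin_cases j <;> fin_cases k <;> fin_cases l <;> simp
  | succ N ih =>
    have key : ∀ (u w : ℂ) (i j k l a c : Fin 2),
        blk a c (monodromy ν u i j * monodromy ν w k l) =
        ∑ m, ∑ n, (Lsc u (ν (Fin.last N)) i m * Lsc w (ν (Fin.last N)) k n) a c •
          (monodromy (fun k => ν k.castSucc) u m j * monodromy (fun k => ν k.castSucc) w n l) := by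
      intro u w i j k l a c
      simp only [blk_mul, blk_monodromy, Matrix.mul_apply, Finset.sum_mul_sum, Finset.sum_smul,
        smul_mul_smul_comm]
      rw [Finset.sum_comm]
      refine Finset.sum_congr rfl fun m _ => ?_
      rw [Finset.sum_comm]
    apply blk_ext
    intro a c
    simp only [blk_add, blk_smul, key]
    set X := monodromy (fun k : Fin N => ν k.castSucc) u
    set Y := monodromy (fun k : Fin N => ν k.castSucc) w
    set v := ν (Fin.last N)
    have h1 : ∀ m n, (u - w) * (Lsc u v i m * Lsc w v k n) a c + (Lsc u v k m * Lsc w v i n) a c =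
        (u - w) * (Lsc w v k n * Lsc u v i m) a c + (Lsc w v k m * Lsc u v i n) a c := by
      intro m n
      have := congrFun (congrFun (Lsc_RTT u w v i k m n) a) c
      simpa using this
    calc _ = ∑ m, ∑ n, ((u - w) * (Lsc u v i m * Lsc w v k n) a c +
          (Lsc u v k m * Lsc w v i n) a c) • (X m j * Y n l) := by
          simp only [add_smul, Finset.sum_add_distrib, Finset.smul_sum, mul_smul]
      _ = ∑ m, ∑ n, ((u - w) * (Lsc w v k n * Lsc u v i m) a c) • (X m j * Y n l) +
          ∑ m, ∑ n, ((Lsc w v k m * Lsc u v i n) a c) • (X m j * Y n l) := by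
          simp only [h1, add_smul, Finset.sum_add_distrib]
      _ = ∑ m, ∑ n, ((u - w) * (Lsc w v k n * Lsc u v i m) a c) • (X m j * Y n l) +
          ∑ m, ∑ n, ((Lsc w v k n * Lsc u v i m) a c) • (X n j * Y m l) := by
          congr 1
          rw [Finset.sum_comm]
      _ = ∑ m, ∑ n, (Lsc w v k n * Lsc u v i m) a c • ((u - w) • (X m j * Y n l) +
            X n j * Y m l) := by
          simp only [← Finset.sum_add_distrib, smul_add, smul_smul]
          simp only [mul_comm]
      _ = ∑ m, ∑ n, (Lsc w v k n * Lsc u v i m) a c • ((u - w) • (Y n l * X m j) +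
            Y n j * X m l) := by
          refine Finset.sum_congr rfl fun m _ => Finset.sum_congr rfl fun n _ => ?_
          rw [ih]
      _ = _ := by
          rw [Finset.sum_comm]
          simp only [smul_add, Finset.sum_add_distrib, Finset.smul_sum, smul_smul]
          simp only [mul_comm]

lemma Bop_commute {N : ℕ} (ν : Fin N → ℂ) (u w : ℂ) : Commute (Bop ν u) (Bop ν w) := by
  have h : ∀ u w : ℂ, u - w + 1 ≠ 0 → Commute (Bop ν u) (Bop ν w) := by
    intro u w hne
    have := monodromy_RTT ν u w 0 1 0 1
    have h2 : (u - w + 1) • (Bop ν u * Bop ν w) = (u - w + 1) • (Bop ν w * Bop ν u) := by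
      simp only [add_smul, one_smul]
      exact this
    exact smul_right_injective _ hne h2
  by_cases h0 : u - w + 1 = 0
  · refine (h w u ?_).symm
    intro h1
    have : (2 : ℂ) = 0 := by linear_combination h0 + h1
    norm_num at this
  · exact h u w h0

lemma Zfun_perm {N : ℕ} (ν lam : Fin N → ℂ) (σ : Equiv.Perm (Fin N)) :
    Zfun N ν (lam ∘ σ) = Zfun N ν lam := by
  unfold Zfun
  refine congrFun (congrFun ?_ _) _
  have hp : (((List.finRange N).reverse).map σ).Perm (List.finRange N).reverse := by
    rw [List.perm_ext_iff_of_nodup]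
    · intro x
      simp only [List.mem_map, List.mem_reverse, List.mem_finRange, true_and, iff_true]
      exact σ.surjective x
    · exact (List.nodup_reverse.2 (List.nodup_finRange N)).map σ.injective
    · exact List.nodup_reverse.2 (List.nodup_finRange N)
  have := hp.map (fun j => Bop ν (lam j))
  rw [List.map_map] at this
  refine this.prod_eq' ?_
  rw [List.pairwise_map]
  exact List.pairwise_iff_getElem.2 fun _ _ _ _ _ => Bop_commute _ _ _

lemma Dop_up {N : ℕ} (ν : Fin N → ℂ) (l : ℂ) (s : Cfg N) :
    Dop ν l s (upCfg N) = if s = upCfg N then ∏ k, (l - ν k) else 0 := by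
  induction N with
  | zero =>
    have : s = upCfg 0 := Subsingleton.elim _ _
    simp [Dop, monodromy, this]
  | succ N ih =>
    obtain ⟨s, a, rfl⟩ : ∃ (t : Cfg N) (a : Fin 2), s = Fin.snoc (α := fun _ => Fin 2) t a :=
      ⟨Fin.init s, s (Fin.last N), by simp⟩
    have hu : upCfg (N + 1) = Fin.snoc (α := fun _ => Fin 2) (upCfg N) 0 := by
      ext i; refine Fin.lastCases ?_ (fun i => ?_) i <;> simp [upCfg]
    have := congrFun (congrFun (blk_monodromy ν l a 0 1 1) s) (upCfg N)
    have h2 := ih (fun k => ν k.castSucc) s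
    simp only [blk, Matrix.of_apply, Fin.sum_univ_two, Matrix.add_apply, Matrix.smul_apply,
      ← hu] at this
    unfold Dop at h2 ⊢
    rw [this, h2, hu, Fin.prod_univ_castSucc]
    fin_cases a <;> simp [Lsc, Fin.snoc_inj, mul_comm]

end SixVertex

namespace SixVertex

lemma degree_C_mul_le_aux (c : ℂ) (q : Polynomial ℂ) :
    (Polynomial.C c * q).degree ≤ q.degree := by
  rw [← Polynomial.smul_eq_C_mul]
  exact Polynomial.degree_smul_le _ _

lemma blk_Bop_00 {N : ℕ} (ν : Fin (N + 1) → ℂ) (l : ℂ) :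
    blk 0 0 (Bop ν l) = (l - ν (Fin.last N) + 1) • Bop (fun k => ν k.castSucc) l := by
  unfold Bop
  rw [blk_monodromy]; simp [Lsc]

lemma blk_Bop_01 {N : ℕ} (ν : Fin (N + 1) → ℂ) (l : ℂ) :
    blk 0 1 (Bop ν l) = 0 := by
  unfold Bop
  rw [blk_monodromy]; simp [Lsc]

lemma blk_Bop_10 {N : ℕ} (ν : Fin (N + 1) → ℂ) (l : ℂ) :
    blk 1 0 (Bop ν l) = Dop (fun k => ν k.castSucc) l := by
  unfold Bop Dop
  rw [blk_monodromy]; simp [Lsc]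

lemma blk_Bop_11 {N : ℕ} (ν : Fin (N + 1) → ℂ) (l : ℂ) :
    blk 1 1 (Bop ν l) = (l - ν (Fin.last N)) • Bop (fun k => ν k.castSucc) l := by
  unfold Bop
  rw [blk_monodromy]; simp [Lsc]

/-- The lower-left block of a product of `B` operators, as a function of the last
inhomogeneity `x`. -/
noncomputable def Gop {N : ℕ} (ν : Fin N → ℂ) (x : ℂ) : List ℂ → Op N
  | [] => 0
  | l :: ls => (ls.map fun t => t - x + 1).prod • (Dop ν l * (ls.map (Bop ν)).prod) +
      (l - x) • (Bop ν l * Gop ν x ls)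

lemma blk_prod {N : ℕ} (ν : Fin (N + 1) → ℂ) (ls : List ℂ) :
    blk 0 0 (ls.map (Bop ν)).prod = (ls.map fun t => t - ν (Fin.last N) + 1).prod •
        (ls.map (Bop fun k => ν k.castSucc)).prod ∧
    blk 1 0 (ls.map (Bop ν)).prod = Gop (fun k => ν k.castSucc) (ν (Fin.last N)) ls := by
  induction ls with
  | nil => simp [blk_one, Gop]
  | cons l ls ih =>
    obtain ⟨h1, h2⟩ := ih
    simp only [List.map_cons, List.prod_cons, blk_mul, Fin.sum_univ_two, h1, h2, blk_Bop_00,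
      blk_Bop_01, blk_Bop_10, blk_Bop_11, Gop]
    constructor
    · simp [smul_smul, mul_comm]
    · simp

lemma Gop_poly {N : ℕ} (ν : Fin N → ℂ) (ls : List ℂ) :
    ∀ s s', ∃ q : Polynomial ℂ, q.degree < ls.length ∧ ∀ x, Gop ν x ls s s' = q.eval x := by
  induction ls with
  | nil => intro s s'; exact ⟨0, by simp, by simp [Gop]⟩
  | cons l ls ih =>
    intro s s'
    choose q hq1 hq2 using ih
    have hprod : ∀ ls : List ℂ, ∃ q : Polynomial ℂ, q.degree ≤ ls.length ∧
        ∀ x, (ls.map fun t => t - x + 1).prod = q.eval x := by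
      intro ls
      induction ls with
      | nil => exact ⟨1, by simp, by simp⟩
      | cons t ls ih =>
        obtain ⟨r, hr, hr2⟩ := ih
        refine ⟨(Polynomial.C (t + 1) - Polynomial.X) * r, ?_, ?_⟩
        · refine (Polynomial.degree_mul_le _ _).trans ?_
          have : (Polynomial.C (t + 1) - Polynomial.X : Polynomial ℂ).degree ≤ 1 := by
            compute_degree
          refine (add_le_add this hr).trans ?_
          simp [add_comm]
        · intro x
          simp only [List.map_cons, List.prod_cons, hr2, Polynomial.eval_mul,
            Polynomial.eval_sub, Polynomial.eval_C, Polynomial.eval_X]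
          ring
    obtain ⟨r, hr, hr2⟩ := hprod ls
    refine ⟨r * Polynomial.C ((Dop ν l * (ls.map (Bop ν)).prod) s s') +
      ∑ t, (Polynomial.C l - Polynomial.X) * (Polynomial.C (Bop ν l s t) * q t s'), ?_, ?_⟩
    · refine (Polynomial.degree_add_le _ _).trans_lt (max_lt ?_ ?_)
      · rw [mul_comm]
        refine (degree_C_mul_le_aux _ _).trans_lt (hr.trans_lt ?_)
        simp only [List.length_cons]
        exact_mod_cast Nat.lt_succ_self _
      · refine (Polynomial.degree_sum_le _ _).trans_lt ?_
        rw [Finset.sup_lt_iff (WithBot.bot_lt_coe _)]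
        intro t _
        refine (Polynomial.degree_mul_le _ _).trans_lt ?_
        have h1 : (Polynomial.C l - Polynomial.X : Polynomial ℂ).degree = 1 := by
          rw [← neg_sub, Polynomial.degree_neg, Polynomial.degree_X_sub_C]
        have h2 := (degree_C_mul_le_aux (Bop ν l s t) (q t s')).trans_lt (hq1 t s')
        rw [h1]
        push_cast [List.length_cons]
        rw [add_comm]
        exact WithBot.add_lt_add_right (by simp) h2
    · intro x
      simp [Gop, Matrix.mul_apply, hr2, hq2, Polynomial.eval_finsetSum, Finset.mul_sum]

lemma Gop_last {N : ℕ} (ν : Fin N → ℂ) (ls : List ℂ) (t : ℂ) :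
    Gop ν (t + 1) (ls ++ [t]) = (ls.map fun l => l - t - 1).prod •
      ((ls.map (Bop ν)).prod * Dop ν t) := by
  induction ls with
  | nil => simp [Gop]
  | cons l ls ih =>
    simp only [List.cons_append, Gop, ih]
    simp [smul_smul, mul_assoc, sub_sub]

lemma Zfun_succ {N : ℕ} (ν lam : Fin (N + 1) → ℂ) :
    Zfun (N + 1) ν lam = Gop (fun k => ν k.castSucc) (ν (Fin.last N))
      ((List.finRange (N + 1)).reverse.map lam) (downCfg N) (upCfg N) := by
  rw [← (blk_prod ν _).2]
  have hu : upCfg (N + 1) = Fin.snoc (α := fun _ => Fin 2) (upCfg N) 0 := by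
    ext i; refine Fin.lastCases ?_ (fun i => ?_) i <;> simp [upCfg]
  have hd : downCfg (N + 1) = Fin.snoc (α := fun _ => Fin 2) (downCfg N) 1 := by
    ext i; refine Fin.lastCases ?_ (fun i => ?_) i <;> simp [downCfg]
  simp only [blk, Matrix.of_apply, ← hu, ← hd, Zfun, List.map_map]
  rfl

lemma Zfun_rec {N : ℕ} (ν lam : Fin (N + 1) → ℂ) (h : ν (Fin.last N) = lam 0 + 1) :
    Zfun (N + 1) ν lam = (∏ j : Fin N, (lam j.succ - lam 0 - 1)) *
      (∏ k : Fin N, (lam 0 - ν k.castSucc)) *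
        Zfun N (fun k => ν k.castSucc) (fun j => lam j.succ) := by
  rw [Zfun_succ, h]
  have : (List.finRange (N + 1)).reverse.map lam =
      (List.finRange N).reverse.map (fun j => lam j.succ) ++ [lam 0] := by
    simp [List.finRange_succ, Function.comp_def]
  rw [this, Gop_last]
  simp only [Matrix.smul_apply, Matrix.mul_apply, Dop_up, smul_eq_mul, mul_ite, mul_zero,
    Finset.sum_ite_eq', Finset.mem_univ, if_true, List.map_map, Zfun]
  have h2 : ((List.finRange N).reverse.map ((fun l => l - lam 0 - 1) ∘ fun j => lam j.succ)).prod =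
      ∏ j : Fin N, (lam j.succ - lam 0 - 1) := by
    rw [List.map_reverse, List.prod_reverse, ← List.ofFn_eq_map, List.prod_ofFn]
    rfl
  rw [h2]
  simp only [Function.comp_def]
  ring

/-- The matrix on the right-hand side, for monomials. -/
noncomputable def Fm {N : ℕ} (ν lam : Fin N → ℂ) : Matrix (Fin N) (Fin N) ℂ :=
  Matrix.of fun j k => lam j ^ (k : ℕ) * (∏ l, (lam j - ν l + 1)) -
    (lam j + 1) ^ (k : ℕ) * ∏ l, (lam j - ν l)

lemma Fm_rec {N : ℕ} (ν lam : Fin (N + 1) → ℂ) (h : ν (Fin.last N) = lam 0 + 1) :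
    (Fm ν lam).det = (∏ k : Fin N, (lam 0 - ν k.castSucc)) *
      ((∏ j : Fin N, ((lam j.succ - lam 0 - 1) * (lam j.succ - lam 0))) *
        (Fm (fun k => ν k.castSucc) (fun j => lam j.succ)).det) := by
  let B : Matrix (Fin (N + 1)) (Fin (N + 1)) ℂ := Matrix.of fun j k =>
    Fin.cases (motive := fun _ => ℂ) (Fm ν lam j 0)
      (fun k => Fm ν lam j k.succ - (lam 0 + 1) * Fm ν lam j k.castSucc) k
  have h1 : (Fm ν lam).det = B.det := by
    refine Matrix.det_eq_of_forall_col_eq_smul_add_pred (fun _ => lam 0 + 1) ?_ ?_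
    · intro i; simp [B]
    · intro i j; simp [B]
  have hB : ∀ j (k : Fin N), B j k.succ = ((lam j - lam 0 - 1) * (lam j - lam 0)) *
      (lam j ^ (k : ℕ) * (∏ l : Fin N, (lam j - ν l.castSucc + 1)) -
        (lam j + 1) ^ (k : ℕ) * ∏ l : Fin N, (lam j - ν l.castSucc)) := by
    intro j k
    simp only [B, Fm, Matrix.of_apply, Fin.cases_succ, Fin.prod_univ_castSucc, h, Fin.val_succ,
      Fin.val_castSucc]
    ring
  rw [h1, Matrix.det_succ_row_zero, Fin.sum_univ_succ]
  have hz : ∀ k : Fin N, B 0 k.succ = 0 := by intro k; rw [hB]; simp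
  have h00 : B 0 0 = ∏ k : Fin N, (lam 0 - ν k.castSucc) := by
    simp only [B, Fm, Matrix.of_apply, Fin.cases_zero, Fin.prod_univ_castSucc, h, Fin.val_zero]
    ring
  simp only [hz, h00, mul_zero, zero_mul, Finset.sum_const_zero, add_zero, Fin.val_zero, pow_zero,
    one_mul]
  rw [← Matrix.det_mul_column (fun j : Fin N => (lam j.succ - lam 0 - 1) * (lam j.succ - lam 0))]
  congr 1
  refine congrArg Matrix.det ?_
  ext j k
  simp [hB, Fm]

lemma Fm_poly {N : ℕ} (ν : Fin N → ℂ) (lam : Fin (N + 1) → ℂ) :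
    ∃ q : Polynomial ℂ, q.degree < ((N + 1 : ℕ) : WithBot ℕ) ∧
      ∀ x, (Fm (Fin.snoc (α := fun _ => ℂ) ν x) lam).det = q.eval x := by
  classical
  let d : Polynomial ℂ := ∏ l, (Polynomial.X - Polynomial.C (ν l))
  have hdm : d.Monic := Polynomial.monic_prod_of_monic _ _ fun i _ => Polynomial.monic_X_sub_C _
  have hdd : d.natDegree = N := by
    simp [d, Polynomial.natDegree_prod_of_monic _ _ fun i _ => Polynomial.monic_X_sub_C (ν i)]
  have hde : ∀ y, d.eval y = ∏ l, (y - ν l) := by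
    intro y; simp [d, Polynomial.eval_prod]
  have hds : ∀ y, d.eval y = ∑ i : Fin (N + 1), d.coeff i * y ^ (i : ℕ) := by
    intro y
    rw [Polynomial.eval_eq_sum_range, hdd, Finset.sum_range]
  let aP : Fin (N + 1) → ℂ := fun j => ∏ l, (lam j - ν l + 1)
  let dP : Fin (N + 1) → ℂ := fun j => ∏ l, (lam j - ν l)
  let P : Matrix (Fin (N + 1)) (Fin (N + 1)) (Polynomial ℂ) := Matrix.of fun j k =>
    if k = Fin.last N then Polynomial.C (dP j * aP j) else
      Polynomial.C (lam j ^ (k : ℕ) * aP j) * (Polynomial.C (lam j + 1) - Polynomial.X) -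
      Polynomial.C ((lam j + 1) ^ (k : ℕ) * dP j) * (Polynomial.C (lam j) - Polynomial.X)
  refine ⟨P.det, ?_, ?_⟩
  · suffices h : P.det.degree ≤ (N : WithBot ℕ) from
      h.trans_lt (by exact_mod_cast Nat.lt_succ_self N)
    rw [Matrix.det_apply]
    refine (Polynomial.degree_sum_le _ _).trans (Finset.sup_le fun σ _ => ?_)
    refine (Polynomial.degree_smul_le _ _).trans ?_
    refine (Polynomial.degree_prod_le _ _).trans ?_
    rw [Fin.sum_univ_castSucc]
    have hlast : (P (σ (Fin.last N)) (Fin.last N)).degree ≤ 0 := by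
      simp only [P, Matrix.of_apply, if_true]
      exact Polynomial.degree_C_le
    have hsub : ∀ c : ℂ, (Polynomial.C c - Polynomial.X : Polynomial ℂ).degree ≤ 1 := by
      intro c
      rw [← neg_sub, Polynomial.degree_neg, Polynomial.degree_X_sub_C]
    have hcast : ∀ k : Fin N, (P (σ k.castSucc) k.castSucc).degree ≤ 1 := by
      intro k
      simp only [P, Matrix.of_apply, (Fin.castSucc_lt_last k).ne, if_false]
      refine (Polynomial.degree_sub_le _ _).trans (max_le ?_ ?_)
      · exact (degree_C_mul_le_aux _ _).trans (hsub _)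
      · exact (degree_C_mul_le_aux _ _).trans (hsub _)
    refine (add_le_add (Finset.sum_le_sum fun k _ => hcast k) hlast).trans ?_
    simp
  · intro x
    have h1 := Matrix.det_updateCol_sum (Fm (Fin.snoc (α := fun _ => ℂ) ν x) lam) (Fin.last N)
      (fun i => d.coeff i)
    have hc : d.coeff (Fin.last N : Fin (N + 1)) = 1 := by
      have := hdm.coeff_natDegree
      rwa [hdd] at this
    rw [hc, one_smul] at h1
    rw [← h1, ← Polynomial.coe_evalRingHom, RingHom.map_det]
    congr 1
    ext j k
    by_cases hk : k = Fin.last N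
    · subst hk
      have e : ∑ i : Fin (N + 1), d.coeff i * Fm (Fin.snoc (α := fun _ => ℂ) ν x) lam j i =
          d.eval (lam j) * (aP j * (lam j - x + 1)) - d.eval (lam j + 1) * (dP j * (lam j - x)) := by
        rw [hds, hds, Finset.sum_mul, Finset.sum_mul, ← Finset.sum_sub_distrib]
        refine Finset.sum_congr rfl fun i _ => ?_
        simp only [Fm, Matrix.of_apply, Fin.prod_univ_castSucc, Fin.snoc_castSucc, Fin.snoc_last,
          aP, dP]
        ring
      have e2 : d.eval (lam j + 1) = aP j := by
        rw [hde]; exact Finset.prod_congr rfl fun i _ => by ring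
      have e3 : d.eval (lam j) = dP j := hde _
      simp only [Matrix.updateCol_self, smul_eq_mul, e, e2, e3, P]
      simp
      ring
    · have ea : ∏ l, (lam j - ν l + 1) = aP j := rfl
      have ed : ∏ l, (lam j - ν l) = dP j := rfl
      clear_value aP dP
      simp [P, hk, Fm, Fin.prod_univ_castSucc, ea, ed]
      ring

theorem Zfun_vandermonde (N : ℕ) (ν lam : Fin N → ℂ) :
    Zfun N ν lam * (Matrix.vandermonde lam).det = (Fm ν lam).det := by
  induction N with
  | zero =>
    have : upCfg 0 = downCfg 0 := Subsingleton.elim _ _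
    simp [Zfun, this]
  | succ N ih =>
    have hrec0 : ∀ ν lam : Fin (N + 1) → ℂ, ν (Fin.last N) = lam 0 + 1 →
        Zfun (N + 1) ν lam * (Matrix.vandermonde lam).det = (Fm ν lam).det := by
      intro ν lam h
      rw [Zfun_rec ν lam h, Fm_rec ν lam h, ← ih, Matrix.det_vandermonde, Matrix.det_vandermonde,
        Fin.prod_univ_succ, Fin.prod_Ioi_zero, Finset.prod_mul_distrib]
      simp only [Fin.prod_Ioi_succ]
      ring
    have hrec : ∀ (ν lam : Fin (N + 1) → ℂ) (m : Fin (N + 1)), ν (Fin.last N) = lam m + 1 →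
        Zfun (N + 1) ν lam * (Matrix.vandermonde lam).det = (Fm ν lam).det := by
      intro ν lam m h
      have h0 := hrec0 ν (lam ∘ Equiv.swap 0 m) (by simpa using h)
      have e1 : Matrix.vandermonde (lam ∘ Equiv.swap 0 m) =
          (Matrix.vandermonde lam).submatrix (Equiv.swap 0 m) id := by
        ext i j; simp [Matrix.vandermonde_apply]
      have e2 : Fm ν (lam ∘ Equiv.swap 0 m) = (Fm ν lam).submatrix (Equiv.swap 0 m) id := by
        ext i j; simp [Fm]
      rw [Zfun_perm, e1, e2, Matrix.det_permute, Matrix.det_permute] at h0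
      rcases Int.units_eq_one_or (Equiv.Perm.sign (Equiv.swap 0 m)) with hs | hs <;>
        rw [hs] at h0 <;> simpa using h0
    by_cases hinj : Function.Injective lam
    · obtain ⟨q, hq1, hq2⟩ := Fm_poly (fun k => ν k.castSucc) lam
      obtain ⟨r, hr1, hr2⟩ := Gop_poly (fun k : Fin N => ν k.castSucc)
        ((List.finRange (N + 1)).reverse.map lam) (downCfg N) (upCfg N)
      have hZ : ∀ x, Zfun (N + 1) (Fin.snoc (α := fun _ => ℂ) (fun k => ν k.castSucc) x) lam =
          r.eval x := by
        intro x
        rw [Zfun_succ, ← hr2]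
        simp
      have key : r * Polynomial.C (Matrix.vandermonde lam).det = q := by
        refine Polynomial.eq_of_degrees_lt_of_eval_index_eq (v := fun m => lam m + 1)
          (Finset.univ : Finset (Fin (N + 1))) ?_ ?_ ?_ ?_
        · intro a _ b _ hab
          exact hinj (add_right_cancel hab)
        · rw [mul_comm]
          refine (degree_C_mul_le_aux _ _).trans_lt ?_
          simpa using hr1
        · simpa using hq1
        · intro m _
          rw [Polynomial.eval_mul, Polynomial.eval_C, ← hZ, ← hq2]
          exact hrec _ _ m (by simp)
      have h1 := congrArg (Polynomial.eval (ν (Fin.last N))) key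
      rw [Polynomial.eval_mul, Polynomial.eval_C, ← hZ, ← hq2] at h1
      have e : (Fin.snoc (α := fun _ => ℂ) (fun k : Fin N => ν k.castSucc) (ν (Fin.last N))) = ν := by
        ext i; refine Fin.lastCases ?_ (fun i => ?_) i <;> simp
      rwa [e] at h1
    · simp only [Function.Injective, not_forall] at hinj
      obtain ⟨i, j, hij, hne⟩ := hinj
      rw [Matrix.det_zero_of_row_eq hne (M := Matrix.vandermonde lam),
        Matrix.det_zero_of_row_eq hne (M := Fm ν lam), mul_zero]
      · ext k; simp [Fm, hij]
      · ext k; simp [Matrix.vandermonde_apply, hij]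

theorem Zfun_det_main (N : ℕ) (ν : Fin N → ℂ) (p : Matrix (Fin N) (Fin N) ℂ) (lam : Fin N → ℂ) :
    Zfun N ν lam * Matrix.det (Matrix.of fun j k : Fin N => pval p k (lam j)) =
      Matrix.det (Matrix.of fun j k : Fin N =>
        pval p k (lam j) * (∏ l, (lam j - ν l + 1)) -
          pval p k (lam j + 1) * ∏ l, (lam j - ν l)) := by
  have e1 : (Matrix.of fun j k : Fin N => pval p k (lam j)) =
      Matrix.vandermonde lam * p.transpose := by
    ext j k
    simp [pval, Matrix.mul_apply, Matrix.vandermonde_apply, mul_comm]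
  have e2 : (Matrix.of fun j k : Fin N =>
        pval p k (lam j) * (∏ l, (lam j - ν l + 1)) -
          pval p k (lam j + 1) * ∏ l, (lam j - ν l)) = Fm ν lam * p.transpose := by
    ext j k
    simp only [pval, Matrix.mul_apply, Fm, Matrix.of_apply, Matrix.transpose_apply,
      Finset.sum_mul, ← Finset.sum_sub_distrib]
    exact Finset.sum_congr rfl fun i _ => by ring
  rw [e1, e2, Matrix.det_mul, Matrix.det_mul, ← mul_assoc, Zfun_vandermonde]

end SixVertex

open SixVertex in
/-- determinant representation, rational case: for `ν` pairwise distinct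
with `ν_j - ν_k ≠ 1` for `j ≠ k`, and any basis `p_1,…,p_N` of polynomials of degree at
most `N-1` (given by an invertible coefficient matrix `p`),
`Z_N(λ) ⬝ det[p_k(λ_j)] = det[p_k(λ_j) a(λ_j) - p_k(λ_j + 1) d(λ_j)]`, where
`a(λ) = ∏_k (λ - ν_k + 1)` and `d(λ) = ∏_k (λ - ν_k)`. -/
theorem Zfun_det_representation (N : ℕ) (hN : 1 ≤ N) (ν : Fin N → ℂ)
    (hν : Function.Injective ν)
    (hν1 : ∀ j k : Fin N, j ≠ k → ν j - ν k ≠ 1)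
    (p : Matrix (Fin N) (Fin N) ℂ) (hp : IsUnit p.det)
    (lam : Fin N → ℂ) :
    Zfun N ν lam * Matrix.det (Matrix.of fun j k : Fin N => pval p k (lam j)) =
      Matrix.det (Matrix.of fun j k : Fin N =>
        pval p k (lam j) * (∏ l, (lam j - ν l + 1)) -
          pval p k (lam j + 1) * ∏ l, (lam j - ν l)) := by
  exact Zfun_det_main N ν p lam
end

section
/- (Kostov representation, rational case.) For any ν_1,…,ν_N ∈ ℂ and all λ_1,…,λ_N ∈ ℂ: Z_N(λ_1,…,λ_N) · ∏_{1≤j<k≤N} (λ_k − λ_j) = det[ λ_j^{k−1} a(λ_j) − (λ_j + 1)^{k−1} d(λ_j) ]_{j,k=1,…,N}, where a(λ) = ∏_{l=1}^N (λ − ν_l + 1) and d(λ) = ∏_{l=1}^N (λ − ν_l). -/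
open scoped BigOperators
set_option linter.all false

namespace SixVertex
open Matrix


lemma siteOp_mul_apply {N : ℕ} (k : Fin N) (M : Matrix (Fin 2) (Fin 2) ℂ) (X : Op N) (s s' : Cfg N) :
    (siteOp k M * X) s s' = ∑ x, M (s k) x * X (Function.update s k x) s' := by
  rw [Matrix.mul_apply]
  symm
  refine Finset.sum_of_injOn (fun x => Function.update s k x) ?_ ?_ ?_ ?_
  · intro x _ y _ h
    have := congrFun h k
    simpa using this
  · simp
  · intro t _ ht
    have : ¬ ∀ i, i ≠ k → s i = t i := by
      intro h
      apply ht
      refine ⟨t k, by simp, ?_⟩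
      ext i
      by_cases hi : i = k
      · subst hi; simp
      · simp [Function.update_of_ne hi, h i hi]
    simp [siteOp, this]
  · intro x _
    have : ∀ i, i ≠ k → s i = Function.update s k x i := by
      intro i hi; simp [Function.update_of_ne hi]
    simp only [siteOp, Matrix.of_apply]
    rw [if_pos this]; simp

lemma siteOp_mul {N : ℕ} (k : Fin N) (M M' : Matrix (Fin 2) (Fin 2) ℂ) :
    siteOp k M * siteOp k M' = siteOp k (M * M') := by
  rw [← mul_one (siteOp k M'), ← mul_one (siteOp k (M * M'))]
  ext s s'
  simp only [siteOp_mul_apply, Fin.sum_univ_two, Function.update_self, Function.update_idem]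
  have e : ∀ x y : Fin 2, Function.update (Function.update s k x) k y = Function.update s k y :=
    fun x y => Function.update_idem (β := fun _ => Fin 2) x y s
  rw [e, e, e, e]
  simp only [Matrix.mul_apply (M := M), Fin.sum_univ_two]
  ring

lemma siteOp_comm {N : ℕ} {k j : Fin N} (h : k ≠ j) (M M' : Matrix (Fin 2) (Fin 2) ℂ) :
    Commute (siteOp k M) (siteOp j M') := by
  unfold Commute SemiconjBy
  rw [← mul_one (siteOp k M), ← mul_one (siteOp j M'), mul_assoc, mul_assoc, one_mul, one_mul]
  ext s s'
  simp only [siteOp_mul_apply, Fin.sum_univ_two, Function.update_of_ne h, Function.update_of_ne h.symm]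
  have e : ∀ x y : Fin 2, Function.update (Function.update s k x) j y =
      Function.update (Function.update s j y) k x :=
    fun x y => Function.update_comm h x y s
  rw [e, e, e, e]
  ring

lemma siteOp_add {N : ℕ} (k : Fin N) (M M' : Matrix (Fin 2) (Fin 2) ℂ) :
    siteOp k (M + M') = siteOp k M + siteOp k M' := by
  ext s s'
  simp only [siteOp, Matrix.of_apply, Matrix.add_apply]
  split_ifs <;> simp

lemma siteOp_smul {N : ℕ} (k : Fin N) (c : ℂ) (M : Matrix (Fin 2) (Fin 2) ℂ) :
    siteOp k (c • M) = c • siteOp k M := by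
  ext s s'
  simp only [siteOp, Matrix.of_apply, Matrix.smul_apply]
  split_ifs <;> simp

lemma siteOp_sub {N : ℕ} (k : Fin N) (M M' : Matrix (Fin 2) (Fin 2) ℂ) :
    siteOp k (M - M') = siteOp k M - siteOp k M' := by
  rw [eq_sub_iff_add_eq, ← siteOp_add, sub_add_cancel]

/-- local 2x2 blocks of the L-operator -/
def ell (v l : ℂ) (i j : Fin 2) : Matrix (Fin 2) (Fin 2) ℂ :=
  (!![aW l v • piPlus + bW l v • piMinus, sigmaMinus;
     sigmaPlus, bW l v • piPlus + aW l v • piMinus] : Matrix (Fin 2) (Fin 2) (Matrix (Fin 2) (Fin 2) ℂ)) i j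

lemma Lop_apply {N : ℕ} (ν : Fin N → ℂ) (k : Fin N) (l : ℂ) (i j : Fin 2) :
    Lop ν k l i j = siteOp k (ell (ν k) l i j) := by
  fin_cases i <;> fin_cases j <;> simp [Lop, ell, siteOp_add, siteOp_smul]

lemma ell_rtt (v x y : ℂ) (i j k l : Fin 2) :
    (x - y) • (ell v x i j * ell v y k l) + ell v x k j * ell v y i l
      = (x - y) • (ell v y k l * ell v x i j) + ell v y k j * ell v x i l := by
  fin_cases i <;> fin_cases j <;> fin_cases k <;> fin_cases l <;>
  · ext p q
    fin_cases p <;> fin_cases q <;>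
    simp [ell, piPlus, piMinus, sigmaPlus, sigmaMinus, aW, bW, Matrix.mul_apply, Fin.sum_univ_two] <;> first | done | ring_nf <;> simp

lemma Lop_rtt {N : ℕ} (ν : Fin N → ℂ) (n : Fin N) (x y : ℂ) (i j k l : Fin 2) :
    (x - y) • (Lop ν n x i j * Lop ν n y k l) + Lop ν n x k j * Lop ν n y i l
      = (x - y) • (Lop ν n y k l * Lop ν n x i j) + Lop ν n y k j * Lop ν n x i l := by
  simp only [Lop_apply, siteOp_mul, ← siteOp_smul, ← siteOp_add]
  rw [ell_rtt]

/-- first-space embedding -/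
def emb1 {A : Type*} [Ring A] (M : Matrix (Fin 2) (Fin 2) A) : Matrix (Fin 2 × Fin 2) (Fin 2 × Fin 2) A :=
  Matrix.of fun p q => if p.2 = q.2 then M p.1 q.1 else 0
/-- second-space embedding -/
def emb2 {A : Type*} [Ring A] (M : Matrix (Fin 2) (Fin 2) A) : Matrix (Fin 2 × Fin 2) (Fin 2 × Fin 2) A :=
  Matrix.of fun p q => if p.1 = q.1 then M p.2 q.2 else 0
/-- the R-matrix -/
def Rm (A : Type*) [Ring A] [Algebra ℂ A] (z : ℂ) : Matrix (Fin 2 × Fin 2) (Fin 2 × Fin 2) A :=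
  Matrix.of fun p q => (if p = q then algebraMap ℂ A z else 0) + if p = q.swap then 1 else 0

section
variable {A : Type*} [Ring A]

lemma emb1_mul (M M' : Matrix (Fin 2) (Fin 2) A) : emb1 (M * M') = emb1 M * emb1 M' := by
  ext ⟨i, k⟩ ⟨j, l⟩
  fin_cases k <;> fin_cases l <;>
  simp [emb1, Matrix.mul_apply, Fintype.sum_prod_type, Fin.sum_univ_two]
lemma emb2_mul (M M' : Matrix (Fin 2) (Fin 2) A) : emb2 (M * M') = emb2 M * emb2 M' := by
  ext ⟨i, k⟩ ⟨j, l⟩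
  fin_cases i <;> fin_cases j <;>
  simp [emb2, Matrix.mul_apply, Fintype.sum_prod_type, Fin.sum_univ_two]
lemma emb1_one : emb1 (1 : Matrix (Fin 2) (Fin 2) A) = 1 := by
  ext ⟨i, k⟩ ⟨j, l⟩
  fin_cases k <;> fin_cases l <;> fin_cases i <;> fin_cases j <;>
  simp [emb1, Matrix.one_apply]
lemma emb2_one : emb2 (1 : Matrix (Fin 2) (Fin 2) A) = 1 := by
  ext ⟨i, k⟩ ⟨j, l⟩
  fin_cases k <;> fin_cases l <;> fin_cases i <;> fin_cases j <;>
  simp [emb2, Matrix.one_apply]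
lemma emb12 (M M' : Matrix (Fin 2) (Fin 2) A) (i j k l : Fin 2) :
    (emb1 M * emb2 M') (i, k) (j, l) = M i j * M' k l := by
  fin_cases k <;> fin_cases l <;> fin_cases i <;> fin_cases j <;>
  simp [emb1, emb2, Matrix.mul_apply, Fintype.sum_prod_type, Fin.sum_univ_two]
lemma emb21 (M M' : Matrix (Fin 2) (Fin 2) A) (i j k l : Fin 2) :
    (emb2 M' * emb1 M) (i, k) (j, l) = M' k l * M i j := by
  fin_cases k <;> fin_cases l <;> fin_cases i <;> fin_cases j <;>
  simp [emb1, emb2, Matrix.mul_apply, Fintype.sum_prod_type, Fin.sum_univ_two]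
lemma Rm_mul [Algebra ℂ A] (z : ℂ) (X : Matrix (Fin 2 × Fin 2) (Fin 2 × Fin 2) A) (i j k l : Fin 2) :
    (Rm A z * X) (i, k) (j, l) = z • X (i, k) (j, l) + X (k, i) (j, l) := by
  fin_cases k <;> fin_cases i <;>
  simp [Rm, Matrix.mul_apply, Fintype.sum_prod_type, Fin.sum_univ_two, Algebra.smul_def, add_mul, add_comm]
lemma mul_Rm [Algebra ℂ A] (z : ℂ) (X : Matrix (Fin 2 × Fin 2) (Fin 2 × Fin 2) A) (i j k l : Fin 2) :
    (X * Rm A z) (i, k) (j, l) = z • X (i, k) (j, l) + X (i, k) (l, j) := by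
  fin_cases j <;> fin_cases l <;>
  simp [Rm, Matrix.mul_apply, Fintype.sum_prod_type, Fin.sum_univ_two, Algebra.smul_def, mul_add, Algebra.commutes, add_comm]

/-- RTT relation in components is equivalent to the matrix form. -/
lemma rtt_iff [Algebra ℂ A] (z : ℂ) (T T' : Matrix (Fin 2) (Fin 2) A) :
    Rm A z * (emb1 T * emb2 T') = emb2 T' * emb1 T * Rm A z ↔
    ∀ i j k l, z • (T i j * T' k l) + T k j * T' i l = z • (T' k l * T i j) + T' k j * T i l := by
  constructor
  · intro h i j k l
    have := congrFun (congrFun h (i, k)) (j, l)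
    rw [Rm_mul, mul_Rm] at this
    simpa only [emb12, emb21] using this
  · intro h
    ext ⟨i, k⟩ ⟨j, l⟩
    rw [Rm_mul, mul_Rm]
    simpa only [emb12, emb21] using h i j k l

lemma emb_comm {T T' : Matrix (Fin 2) (Fin 2) A} (h : ∀ i j k l, Commute (T i j) (T' k l)) :
    Commute (emb1 T) (emb2 T') := by
  show _ = _
  ext ⟨i, k⟩ ⟨j, l⟩
  rw [emb12, emb21]; exact h _ _ _ _
end

/-- partial monodromy -/
def mono {N : ℕ} (ν : Fin N → ℂ) (L : List (Fin N)) (x : ℂ) : Matrix (Fin 2) (Fin 2) (Op N) :=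
  (L.map fun k => Lop ν k x).prod

lemma emb1_mono_comm {N : ℕ} (ν : Fin N → ℂ) (L : List (Fin N)) (k : Fin N) (hk : k ∉ L) (x y : ℂ) :
    Commute (emb1 (mono ν L x)) (emb2 (Lop ν k y)) := by
  induction L with
  | nil => simp [mono, emb1_one]
  | cons j L ih =>
    simp only [List.mem_cons, not_or] at hk
    have : mono ν (j :: L) x = Lop ν j x * mono ν L x := by simp [mono]
    rw [this, emb1_mul]
    refine Commute.mul_left (emb_comm ?_) (ih hk.2)
    intro a b c d
    rw [Lop_apply, Lop_apply]
    exact siteOp_comm (Ne.symm hk.1) _ _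

lemma emb2_mono_comm {N : ℕ} (ν : Fin N → ℂ) (L : List (Fin N)) (k : Fin N) (hk : k ∉ L) (x y : ℂ) :
    Commute (emb1 (Lop ν k y)) (emb2 (mono ν L x)) := by
  induction L with
  | nil => simp [mono, emb2_one]
  | cons j L ih =>
    simp only [List.mem_cons, not_or] at hk
    have : mono ν (j :: L) x = Lop ν j x * mono ν L x := by simp [mono]
    rw [this, emb2_mul]
    refine Commute.mul_right (emb_comm ?_) (ih hk.2)
    intro a b c d
    rw [Lop_apply, Lop_apply]
    exact siteOp_comm hk.1 _ _

lemma mono_rtt {N : ℕ} (ν : Fin N → ℂ) (L : List (Fin N)) (hL : L.Nodup) (x y : ℂ) :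
    Rm (Op N) (x - y) * (emb1 (mono ν L x) * emb2 (mono ν L y)) =
      emb2 (mono ν L y) * emb1 (mono ν L x) * Rm (Op N) (x - y) := by
  induction L with
  | nil => simp [mono, emb1_one, emb2_one]
  | cons k L ih =>
    obtain ⟨hk, hL⟩ := List.nodup_cons.1 hL
    have e : ∀ x, mono ν (k :: L) x = Lop ν k x * mono ν L x := by intro x; simp [mono]
    rw [e, e, emb1_mul, emb2_mul]
    have h1 := (rtt_iff (x - y) (Lop ν k x) (Lop ν k y)).2 (Lop_rtt ν k x y)
    have h2 := (emb1_mono_comm ν L k hk x y).eq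
    have h3 := (emb2_mono_comm ν L k hk y x).eq
    have ih := ih hL
    generalize Rm (Op N) (x - y) = R at *
    generalize emb1 (Lop ν k x) = X at *
    generalize emb2 (Lop ν k y) = Y at *
    generalize emb1 (mono ν L x) = X' at *
    generalize emb2 (mono ν L y) = Y' at *
    calc R * (X * X' * (Y * Y')) = R * (X * (X' * Y) * Y') := by simp only [mul_assoc]
      _ = R * (X * Y) * (X' * Y') := by rw [h2]; simp only [mul_assoc]
      _ = Y * X * (R * (X' * Y')) := by rw [h1]; simp only [mul_assoc]
      _ = Y * (X * Y') * X' * R := by rw [ih]; simp only [mul_assoc]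
      _ = _ := by rw [h3]; simp only [mul_assoc]

lemma monodromy_eq {N : ℕ} (ν : Fin N → ℂ) (x : ℂ) :
    monodromy ν x = mono ν (List.finRange N).reverse x := rfl

lemma rtt {N : ℕ} (ν : Fin N → ℂ) (x y : ℂ) (i j k l : Fin 2) :
    (x - y) • (monodromy ν x i j * monodromy ν y k l) + monodromy ν x k j * monodromy ν y i l
      = (x - y) • (monodromy ν y k l * monodromy ν x i j) + monodromy ν y k j * monodromy ν x i l :=
  (rtt_iff _ _ _).1 (mono_rtt ν _ (List.nodup_reverse.2 (List.nodup_finRange N)) x y) i j k l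

lemma BB {N : ℕ} (ν : Fin N → ℂ) (x y : ℂ) : Bop ν x * Bop ν y = Bop ν y * Bop ν x := by
  have h1 := rtt ν x y 0 1 0 1
  have h2 := rtt ν y x 0 1 0 1
  unfold Bop
  generalize monodromy ν x 0 1 * monodromy ν y 0 1 = P at *
  generalize monodromy ν y 0 1 * monodromy ν x 0 1 = Q at *
  have : (2 : ℂ) • P = (2 : ℂ) • Q := by
    linear_combination (norm := module) h1 - h2
  exact smul_right_injective _ two_ne_zero this

lemma AB {N : ℕ} (ν : Fin N → ℂ) (m x : ℂ) (h : m ≠ x) :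
    Aop ν m * Bop ν x = ((m - x - 1) / (m - x)) • (Bop ν x * Aop ν m) + (1 / (m - x)) • (Bop ν m * Aop ν x) := by
  have h1 := rtt ν x m 0 1 0 0
  have hne : m - x ≠ 0 := sub_ne_zero.2 h
  have : (m - x) • (Aop ν m * Bop ν x) = (m - x - 1) • (Bop ν x * Aop ν m) + (Bop ν m * Aop ν x) := by
    unfold Aop Bop
    linear_combination (norm := module) h1
  have h2 := congrArg (fun z => (1 / (m - x)) • z) this
  simp only [smul_add, smul_smul] at h2
  rw [one_div_mul_cancel hne, one_smul] at h2
  rw [h2]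
  congr 2
  ring
end SixVertex

namespace SixVertex
open Matrix

/-- total lowering operator -/
def Sm (N : ℕ) : Op N := ∑ k, siteOp k sigmaMinus

lemma Sm_comm {N : ℕ} (k : Fin N) (M : Matrix (Fin 2) (Fin 2) ℂ) :
    Sm N * siteOp k M = siteOp k M * Sm N + siteOp k (sigmaMinus * M - M * sigmaMinus) := by
  have h : Sm N = siteOp k sigmaMinus + ∑ j ∈ Finset.univ.erase k, siteOp j sigmaMinus :=
    (Finset.add_sum_erase _ _ (Finset.mem_univ k)).symm
  have h2 : Commute (∑ j ∈ Finset.univ.erase k, siteOp j sigmaMinus) (siteOp k M) :=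
    Commute.sum_left _ _ _ (fun j hj => siteOp_comm (Finset.ne_of_mem_erase hj) _ _)
  rw [h, add_mul, mul_add, h2.eq, siteOp_sub, siteOp_mul, siteOp_mul]
  abel

/-- auxiliary-space dressed lowering operator -/
def Um (N : ℕ) : Matrix (Fin 2) (Fin 2) (Op N) := !![Sm N, 0; 1, Sm N]

lemma Um_Lop {N : ℕ} (ν : Fin N → ℂ) (k : Fin N) (x : ℂ) : Commute (Um N) (Lop ν k x) := by
  have e1 : sigmaMinus * ell (ν k) x 0 0 - ell (ν k) x 0 0 * sigmaMinus = ell (ν k) x 0 1 := by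
    ext p q; fin_cases p <;> fin_cases q <;>
      simp [ell, piPlus, piMinus, sigmaPlus, sigmaMinus, aW, bW, Matrix.mul_apply]
  have e2 : sigmaMinus * ell (ν k) x 0 1 - ell (ν k) x 0 1 * sigmaMinus = 0 := by
    ext p q; fin_cases p <;> fin_cases q <;>
      simp [ell, piPlus, piMinus, sigmaPlus, sigmaMinus, aW, bW, Matrix.mul_apply]
  have e3 : sigmaMinus * ell (ν k) x 1 0 - ell (ν k) x 1 0 * sigmaMinus = ell (ν k) x 1 1 - ell (ν k) x 0 0 := by
    ext p q; fin_cases p <;> fin_cases q <;>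
      simp [ell, piPlus, piMinus, sigmaPlus, sigmaMinus, aW, bW, Matrix.mul_apply]
  have e4 : sigmaMinus * ell (ν k) x 1 1 - ell (ν k) x 1 1 * sigmaMinus = - ell (ν k) x 0 1 := by
    ext p q; fin_cases p <;> fin_cases q <;>
      simp [ell, piPlus, piMinus, sigmaPlus, sigmaMinus, aW, bW, Matrix.mul_apply]
  have z : siteOp k (0 : Matrix (Fin 2) (Fin 2) ℂ) = 0 := by
    ext s s'; simp [siteOp]
  have e4' : siteOp k (- ell (ν k) x 0 1) = - siteOp k (ell (ν k) x 0 1) := by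
    rw [← zero_sub, siteOp_sub, z, zero_sub]
  show _ = _
  ext1 i j
  fin_cases i <;> fin_cases j <;>
    simp only [Um, Matrix.mul_apply, Fin.sum_univ_two, Lop_apply, Fin.zero_eta, Fin.mk_one, Fin.isValue,
      Matrix.of_apply, Matrix.cons_val', Matrix.cons_val_zero, Matrix.cons_val_one, Matrix.cons_val_fin_one,
      Sm_comm, e1, e2, e3, e4, zero_mul, mul_zero, one_mul, mul_one, z, siteOp_sub, e4'] <;>
    abel

lemma Um_monodromy {N : ℕ} (ν : Fin N → ℂ) (x : ℂ) : Commute (Um N) (monodromy ν x) := by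
  unfold monodromy
  apply Commute.list_prod_right
  intro y hy
  obtain ⟨k, _, rfl⟩ := List.mem_map.1 hy
  exact Um_Lop ν k x

lemma SA {N : ℕ} (ν : Fin N → ℂ) (x : ℂ) : Sm N * Aop ν x = Aop ν x * Sm N + Bop ν x := by
  have := congrFun (congrFun (Um_monodromy ν x).eq 0) 0
  simpa [Um, Aop, Bop, Matrix.mul_apply, Fin.sum_univ_two] using this

lemma SB {N : ℕ} (ν : Fin N → ℂ) (x : ℂ) : Sm N * Bop ν x = Bop ν x * Sm N := by
  have := congrFun (congrFun (Um_monodromy ν x).eq 0) 1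
  simpa [Um, Aop, Bop, Matrix.mul_apply, Fin.sum_univ_two] using this

lemma SpowA {N : ℕ} (ν : Fin N → ℂ) (x : ℂ) (m : ℕ) :
    Sm N ^ (m + 1) * Aop ν x = Aop ν x * Sm N ^ (m + 1) + ((m : ℂ) + 1) • (Sm N ^ m * Bop ν x) := by
  have hB : ∀ m, Sm N ^ m * Bop ν x = Bop ν x * Sm N ^ m := fun m =>
    ((show Commute (Sm N) (Bop ν x) from SB ν x).pow_left m).eq
  induction m with
  | zero => simp [SA]
  | succ m ih =>
    rw [pow_succ' _ (m + 1), mul_assoc, ih, mul_add, ← mul_assoc, SA, add_mul, mul_assoc, ← pow_succ',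
      ← hB, mul_smul_comm, ← mul_assoc, ← pow_succ']
    push_cast
    module

lemma row_zero {N : ℕ} (ν : Fin N → ℂ) (x : ℂ) (L : List (Fin N)) (hL : L.Nodup) :
    (∀ (X : Op N) s, (mono ν L x 0 0 * X) (downCfg N) s = (L.map fun k => x - ν k).prod * X (downCfg N) s) ∧
    (∀ (X : Op N) s, (mono ν L x 1 0 * X) (downCfg N) s = 0) := by
  induction L with
  | nil => constructor <;> intro X s <;> simp [mono]
  | cons k L ih =>
    obtain ⟨hk, hL⟩ := List.nodup_cons.1 hL
    obtain ⟨h1, h2⟩ := ih hL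
    have e : mono ν (k :: L) x = Lop ν k x * mono ν L x := by simp [mono]
    have hu : Function.update (downCfg N) k 1 = downCfg N := by
      ext i; by_cases hi : i = k
      · subst hi; simp [downCfg]
      · simp [Function.update_of_ne hi]
    have l00 : ∀ (X : Op N) s, (Lop ν k x 0 0 * X) (downCfg N) s = (x - ν k) * X (downCfg N) s := by
      intro X s
      rw [Lop_apply, siteOp_mul_apply, Fin.sum_univ_two, hu]
      simp [ell, piPlus, piMinus, downCfg, aW, bW]
    have l11 : ∀ (X : Op N) s, (Lop ν k x 1 1 * X) (downCfg N) s = (x - ν k + 1) * X (downCfg N) s := by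
      intro X s
      rw [Lop_apply, siteOp_mul_apply, Fin.sum_univ_two, hu]
      simp [ell, piPlus, piMinus, downCfg, aW, bW]
    have l10 : ∀ (X : Op N) s, (Lop ν k x 1 0 * X) (downCfg N) s = 0 := by
      intro X s
      rw [Lop_apply, siteOp_mul_apply, Fin.sum_univ_two, hu]
      simp [ell, sigmaPlus, downCfg]
    have hc : Lop ν k x 0 1 * mono ν L x 1 0 = mono ν L x 1 0 * Lop ν k x 0 1 := by
      have := congrFun (congrFun (emb2_mono_comm ν L k hk x x).eq (0, 1)) (1, 0)
      rwa [emb12, emb21] at this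
    constructor
    · intro X s
      rw [e, Matrix.mul_apply (M := Lop ν k x), Fin.sum_univ_two, hc, add_mul, mul_assoc, mul_assoc, Matrix.add_apply,
        l00, h1, h2]
      simp [mul_assoc]
    · intro X s
      rw [e, Matrix.mul_apply (M := Lop ν k x), Fin.sum_univ_two, add_mul, mul_assoc, mul_assoc, Matrix.add_apply,
        l10, l11, h2]
      simp

lemma siteOp_mulVec {N : ℕ} (k : Fin N) (M : Matrix (Fin 2) (Fin 2) ℂ) (v : Cfg N → ℂ) (s : Cfg N) :
    (siteOp k M *ᵥ v) s = ∑ x, M (s k) x * v (Function.update s k x) := by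
  have := siteOp_mul_apply k M (Matrix.of fun t _ => v t) s s
  simpa [Matrix.mul_apply, Matrix.mulVec, dotProduct] using this

lemma upVec_apply {N : ℕ} (s : Cfg N) : upVec N s = if s = upCfg N then 1 else 0 := by
  simp [upVec, basisVec, Pi.single_apply]

lemma siteOp_up {N : ℕ} (k : Fin N) (M : Matrix (Fin 2) (Fin 2) ℂ) (h : M 1 0 = 0) :
    siteOp k M *ᵥ upVec N = M 0 0 • upVec N := by
  ext s
  have h1 : Function.update s k 1 ≠ upCfg N := by
    intro h; have := congrFun h k; simp [upCfg] at this
  rw [siteOp_mulVec, Fin.sum_univ_two, Pi.smul_apply, upVec_apply, upVec_apply, upVec_apply, if_neg h1]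
  obtain hs | hs : s k = 0 ∨ s k = 1 := by omega
  · have : Function.update s k 0 = s := by rw [← hs, Function.update_eq_self]
    rw [this, hs]; simp
  · have : s ≠ upCfg N := by rintro rfl; simp [upCfg] at hs
    rw [hs, h, if_neg this]; simp

lemma col_up {N : ℕ} (ν : Fin N → ℂ) (x : ℂ) (L : List (Fin N)) :
    mono ν L x 0 0 *ᵥ upVec N = (L.map fun k => x - ν k + 1).prod • upVec N ∧
    mono ν L x 1 0 *ᵥ upVec N = 0 := by
  induction L with
  | nil => constructor <;> simp [mono]
  | cons k L ih =>
    obtain ⟨h1, h2⟩ := ih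
    have e : mono ν (k :: L) x = Lop ν k x * mono ν L x := by simp [mono]
    have l00 : Lop ν k x 0 0 *ᵥ upVec N = (x - ν k + 1) • upVec N := by
      rw [Lop_apply, siteOp_up] <;> simp [ell, piPlus, piMinus, aW, bW]
    have l10 : Lop ν k x 1 0 *ᵥ upVec N = 0 := by
      rw [Lop_apply, siteOp_up] <;> simp [ell, sigmaPlus]
    rw [e]
    simp only [Matrix.mul_apply, Fin.sum_univ_two, Matrix.add_mulVec, ← Matrix.mulVec_mulVec, h1, h2,
      Matrix.mulVec_smul, l00, l10, Matrix.mulVec_zero, add_zero, smul_zero, smul_smul]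
    simp [mul_comm]

lemma prod_rev {N : ℕ} (f : Fin N → ℂ) : ((List.finRange N).reverse.map f).prod = ∏ l, f l := by
  rw [List.map_reverse, List.prod_reverse, ← List.ofFn_eq_map, List.prod_ofFn]

lemma A_up {N : ℕ} (ν : Fin N → ℂ) (x : ℂ) :
    Aop ν x *ᵥ upVec N = (∏ l, (x - ν l + 1)) • upVec N := by
  rw [← prod_rev]; exact (col_up ν x _).1

lemma A_down {N : ℕ} (ν : Fin N → ℂ) (x : ℂ) (v : Cfg N → ℂ) :
    (Aop ν x *ᵥ v) (downCfg N) = (∏ l, (x - ν l)) * v (downCfg N) := by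
  have := (row_zero ν x _ (List.nodup_reverse.2 (List.nodup_finRange N))).1
    (Matrix.of fun t _ => v t) (downCfg N)
  rw [prod_rev] at this
  simpa [Aop, monodromy_eq, Matrix.mul_apply, Matrix.mulVec, dotProduct] using this

lemma Spow_up (N m : ℕ) (s : Cfg N) :
    (Sm N ^ m *ᵥ upVec N) s = if (Finset.univ.filter fun i => s i = 1).card = m then (m.factorial : ℂ) else 0 := by
  induction m generalizing s with
  | zero =>
    rw [pow_zero, Matrix.one_mulVec, upVec_apply]
    have : s = upCfg N ↔ (Finset.univ.filter fun i => s i = 1).card = 0 := by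
      rw [Finset.card_eq_zero, Finset.filter_eq_empty_iff]
      constructor
      · rintro rfl; simp [upCfg]
      · intro h; ext i
        have := @h i (Finset.mem_univ i)
        simp [upCfg]; omega
    simp [this]
  | succ m ih =>
    rw [pow_succ', ← Matrix.mulVec_mulVec]
    have : ∀ k : Fin N, (siteOp k sigmaMinus *ᵥ (Sm N ^ m *ᵥ upVec N)) s =
        if s k = 1 then (if (Finset.univ.filter fun i => s i = 1).card = m + 1 then (m.factorial : ℂ) else 0) else 0 := by
      intro k
      rw [siteOp_mulVec, Fin.sum_univ_two, ih, ih]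
      obtain hs | hs : s k = 0 ∨ s k = 1 := by omega
      · simp [hs, sigmaMinus]
      · have : (Finset.univ.filter fun i => Function.update s k 0 i = 1) =
            (Finset.univ.filter fun i => s i = 1).erase k := by
          ext i
          by_cases hi : i = k
          · subst hi; simp
          · simp [hi, Function.update_of_ne hi]
        rw [this]
        have hk : k ∈ (Finset.univ.filter fun i => s i = 1) := by simp [hs]
        have hc := Finset.card_erase_add_one hk
        have : ((Finset.univ.filter fun i => s i = 1).erase k).card = m ↔
          (Finset.univ.filter fun i => s i = 1).card = m + 1 := by omega
        simp only [this]
        simp [hs, sigmaMinus]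
    conv_lhs => rw [Sm, Matrix.sum_mulVec, Finset.sum_apply]
    simp only [← Sm.eq_1, this]
    rw [← Finset.sum_filter, Finset.sum_const, nsmul_eq_mul]
    split_ifs with h
    · rw [h, Nat.factorial_succ]; push_cast; ring
    · simp

lemma Spow_base (N : ℕ) : (Sm N ^ N *ᵥ upVec N) (downCfg N) = (N.factorial : ℂ) := by
  rw [Spow_up, if_pos]; simp [downCfg]

end SixVertex

namespace SixVertex
open Matrix

instance BleftComm {N : ℕ} (ν : Fin N → ℂ) :
    LeftCommutative (fun (x : ℂ) (v : Cfg N → ℂ) => Bop ν x *ᵥ v) :=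
  ⟨fun x y v => by simp only [Matrix.mulVec_mulVec, BB ν x y]⟩

/-- off-shell Bethe vector -/
def Phi {N : ℕ} (ν : Fin N → ℂ) (s : Multiset ℂ) : Cfg N → ℂ :=
  s.foldr (fun (x : ℂ) (v : Cfg N → ℂ) => Bop ν x *ᵥ v) (upVec N)

lemma Phi_insert {N : ℕ} (ν : Fin N → ℂ) (s : Finset ℂ) (x : ℂ) (h : x ∉ s) :
    Phi ν (insert x s).val = Bop ν x *ᵥ Phi ν s.val := by
  rw [Finset.insert_val_of_notMem h, Phi, Multiset.foldr_cons, Phi]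

lemma A_Phi {N : ℕ} (ν : Fin N → ℂ) (s : Finset ℂ) (m : ℂ) (hm : m ∉ s) :
    Aop ν m *ᵥ Phi ν s.val =
      ((∏ l, (m - ν l + 1)) * ∏ x ∈ s, ((m - x - 1) / (m - x))) • Phi ν s.val +
      ∑ x ∈ s, ((∏ l, (x - ν l + 1)) * (1 / (m - x)) * ∏ y ∈ s.erase x, ((x - y - 1) / (x - y))) •
        (Bop ν m *ᵥ Phi ν (s.erase x).val) := by
  induction s using Finset.induction_on generalizing m with
  | empty => simp [Phi, A_up]
  | insert z s hz ih =>
    simp only [Finset.mem_insert, not_or] at hm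
    obtain ⟨hmz, hms⟩ := hm
    have e : ∀ x ∈ s, (insert z s).erase x = insert z (s.erase x) := by
      intro x hx
      rw [Finset.erase_insert_of_ne]
      rintro rfl; exact hz hx
    rw [Phi_insert _ _ _ hz, Matrix.mulVec_mulVec, AB ν m z hmz, Matrix.add_mulVec,
      Matrix.smul_mulVec, Matrix.smul_mulVec, ← Matrix.mulVec_mulVec, ← Matrix.mulVec_mulVec,
      ih m hms, ih z hz, Finset.prod_insert hz, Finset.sum_insert hz, Finset.erase_insert hz]
    have : ∑ x ∈ s, ((∏ l, (x - ν l + 1)) * (1 / (m - x)) * ∏ y ∈ (insert z s).erase x, ((x - y - 1) / (x - y))) •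
        (Bop ν m *ᵥ Phi ν ((insert z s).erase x).val) =
      (∑ x ∈ s, (((m - z - 1) / (m - z)) * ((∏ l, (x - ν l + 1)) * (1 / (m - x)) * ∏ y ∈ s.erase x, ((x - y - 1) / (x - y)))) •
        (Bop ν z *ᵥ (Bop ν m *ᵥ Phi ν (s.erase x).val))) +
      ∑ x ∈ s, ((1 / (m - z)) * ((∏ l, (x - ν l + 1)) * (1 / (z - x)) * ∏ y ∈ s.erase x, ((x - y - 1) / (x - y)))) •
        (Bop ν m *ᵥ (Bop ν z *ᵥ Phi ν (s.erase x).val)) := by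
      rw [← Finset.sum_add_distrib]
      refine Finset.sum_congr rfl fun x hx => ?_
      have hz' : z ∉ s.erase x := fun h => hz (Finset.mem_of_mem_erase h)
      rw [e x hx, Phi_insert _ _ _ hz', Finset.prod_insert hz']
      have : Bop ν z *ᵥ (Bop ν m *ᵥ Phi ν (s.erase x).val) = Bop ν m *ᵥ (Bop ν z *ᵥ Phi ν (s.erase x).val) := by
        rw [Matrix.mulVec_mulVec, BB, ← Matrix.mulVec_mulVec]
      rw [this, ← add_smul]
      congr 1
      have h1 : m - z ≠ 0 := sub_ne_zero.2 hmz
      have h2 : m - x ≠ 0 := sub_ne_zero.2 (by rintro rfl; exact hms hx)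
      have h3 : z - x ≠ 0 := sub_ne_zero.2 (by rintro rfl; exact hz hx)
      have h4 : x - z ≠ 0 := sub_ne_zero.2 (by rintro rfl; exact hz hx)
      have key : 1 / (m - x) * ((x - z - 1) / (x - z)) =
        (m - z - 1) / (m - z) * (1 / (m - x)) + 1 / (m - z) * (1 / (z - x)) := by
        have : z - x = - (x - z) := by ring
        rw [this]
        field_simp
        ring
      linear_combination ((∏ l, (x - ν l + 1)) * ∏ y ∈ s.erase x, ((x - y - 1) / (x - y))) * key
    rw [this]
    simp only [Matrix.mulVec_add, Matrix.mulVec_smul, Matrix.mulVec_sum, smul_add, Finset.smul_sum, smul_smul]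
    have c1 : (m - z - 1) / (m - z) * ((∏ l, (m - ν l + 1)) * ∏ x ∈ s, ((m - x - 1) / (m - x))) =
      (∏ l, (m - ν l + 1)) * ((m - z - 1) / (m - z) * ∏ x ∈ s, ((m - x - 1) / (m - x))) := by ring
    have c2 : 1 / (m - z) * ((∏ l, (z - ν l + 1)) * ∏ x ∈ s, ((z - x - 1) / (z - x))) =
      (∏ l, (z - ν l + 1)) * (1 / (m - z)) * ∏ x ∈ s, ((z - x - 1) / (z - x)) := by ring
    rw [c1, c2]
    abel

/-- partial domain wall partition function -/
def zeta {N : ℕ} (ν : Fin N → ℂ) (m : ℕ) (s : Finset ℂ) : ℂ :=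
  (Sm N ^ m *ᵥ Phi ν s.val) (downCfg N)

lemma zeta_rec {N : ℕ} (ν : Fin N → ℂ) (m : ℕ) (s : Finset ℂ) (z : ℂ) (hz : z ∉ s) :
    ((m : ℂ) + 1) * zeta ν m (insert z s) =
      ((∏ l, (z - ν l + 1)) * (∏ x ∈ s, ((z - x - 1) / (z - x))) - ∏ l, (z - ν l)) * zeta ν (m + 1) s +
      ∑ x ∈ s, ((∏ l, (x - ν l + 1)) * (1 / (z - x)) * ∏ y ∈ s.erase x, ((x - y - 1) / (x - y))) *
        zeta ν (m + 1) (insert z (s.erase x)) := by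
  have h1 := congrArg (fun M => (M *ᵥ Phi ν s.val) (downCfg N)) (SpowA ν z m)
  simp only [Matrix.add_mulVec, Matrix.smul_mulVec, ← Matrix.mulVec_mulVec, Pi.add_apply, Pi.smul_apply,
    A_down] at h1
  rw [← Phi_insert _ _ _ hz, A_Phi ν s z hz] at h1
  have h2 : ∑ x ∈ s, ((∏ l, (x - ν l + 1)) * (1 / (z - x)) * ∏ y ∈ s.erase x, ((x - y - 1) / (x - y))) •
        (Bop ν z *ᵥ Phi ν (s.erase x).val) =
      ∑ x ∈ s, ((∏ l, (x - ν l + 1)) * (1 / (z - x)) * ∏ y ∈ s.erase x, ((x - y - 1) / (x - y))) •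
        (Phi ν (insert z (s.erase x)).val) := by
    refine Finset.sum_congr rfl fun x hx => ?_
    rw [Phi_insert _ _ _ (fun h => hz (Finset.mem_of_mem_erase h))]
  rw [h2] at h1
  simp only [Matrix.mulVec_add, Matrix.mulVec_smul, Matrix.mulVec_sum, Pi.add_apply, Pi.smul_apply,
    Finset.sum_apply, smul_eq_mul] at h1
  unfold zeta
  linear_combination -h1

lemma zeta_rec' {N : ℕ} (ν : Fin N → ℂ) (m : ℕ) (s : Finset ℂ) (z : ℂ) (hz : z ∉ s) :
    ((m : ℂ) + 1) * zeta ν m (insert z s) =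
      ∑ x ∈ insert z s, (((∏ l, (x - ν l + 1)) * (∏ y ∈ s, (x - (1 + y))) - (∏ l, (x - ν l)) * ∏ y ∈ s, (x + 1 - (1 + y)))
        / ∏ y ∈ (insert z s).erase x, (x - y)) * zeta ν (m + 1) ((insert z s).erase x) := by
  rw [zeta_rec ν m s z hz, Finset.sum_insert hz, Finset.erase_insert hz]
  congr 1
  · congr 1
    have h0 : ∏ y ∈ s, (z - y) ≠ 0 := Finset.prod_ne_zero_iff.2 fun y hy =>
      sub_ne_zero.2 (by rintro rfl; exact hz hy)
    rw [Finset.prod_div_distrib, eq_div_iff h0, sub_mul, mul_assoc, div_mul_cancel₀ _ h0]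
    congr 2
    · exact Finset.prod_congr rfl fun y _ => by ring
    · exact Finset.prod_congr rfl fun y _ => by ring
  · refine Finset.sum_congr rfl fun x hx => ?_
    have hzx : z ≠ x := by rintro rfl; exact hz hx
    have hz' : z ∉ s.erase x := fun h => hz (Finset.mem_of_mem_erase h)
    rw [Finset.erase_insert_of_ne hzx]
    congr 1
    rw [Finset.prod_insert hz']
    have e1 : ∏ y ∈ s, (x + 1 - (1 + y)) = 0 := Finset.prod_eq_zero hx (by ring)
    have e2 : ∏ y ∈ s, (x - (1 + y)) = - ∏ y ∈ s.erase x, (x - y - 1) := by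
      rw [← Finset.mul_prod_erase _ _ hx]
      have : ∏ y ∈ s.erase x, (x - (1 + y)) = ∏ y ∈ s.erase x, (x - y - 1) :=
        Finset.prod_congr rfl fun y _ => by ring
      rw [this]; ring
    have h0 : ∏ y ∈ s.erase x, (x - y) ≠ 0 := Finset.prod_ne_zero_iff.2 fun y hy =>
      sub_ne_zero.2 (Finset.ne_of_mem_erase hy).symm
    have h1 : z - x ≠ 0 := sub_ne_zero.2 hzx
    have h2 : x - z = - (z - x) := by ring
    rw [e1, e2, Finset.prod_div_distrib, h2]
    field_simp
    ring

/-- generalized Kostov matrix -/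
def KM (al be : ℂ → ℂ) {n : ℕ} (lam : Fin n → ℂ) : Matrix (Fin n) (Fin n) ℂ :=
  Matrix.of fun j k => lam j ^ (k : ℕ) * al (lam j) - (lam j + 1) ^ (k : ℕ) * be (lam j)

lemma KM_expand (al be : ℂ → ℂ) {n : ℕ} (lam : Fin (n + 1) → ℂ) (p : Polynomial ℂ) (hp : p.Monic)
    (hn : p.natDegree = n) :
    (KM al be lam).det = ∑ i : Fin (n + 1), (-1) ^ ((i : ℕ) + n) *
      (al (lam i) * p.eval (lam i) - be (lam i) * p.eval (lam i + 1)) * (KM al be (lam ∘ i.succAbove)).det := by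
  have h := Matrix.det_updateCol_sum (KM al be lam) (Fin.last n) (fun k => p.coeff k)
  have hc : p.coeff (Fin.last n : ℕ) = 1 := by
    rw [Fin.val_last, ← hn]; exact hp
  rw [hc, one_smul] at h
  rw [← h, Matrix.det_succ_column _ (Fin.last n)]
  refine Finset.sum_congr rfl fun i _ => ?_
  congr 2
  · rw [Matrix.updateCol_self]
    have hev : ∀ x, p.eval x = ∑ k : Fin (n + 1), p.coeff k * x ^ (k : ℕ) := by
      intro x
      rw [Polynomial.eval_eq_sum_range, hn, Finset.sum_range]
    rw [hev, hev, Finset.mul_sum, Finset.mul_sum, ← Finset.sum_sub_distrib]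
    refine Finset.sum_congr rfl fun k _ => ?_
    simp only [KM, Matrix.of_apply, smul_eq_mul]
    ring
  · ext j k
    simp [KM, Matrix.submatrix_apply, Fin.succAbove_last, Matrix.updateCol_apply, (Fin.castSucc_lt_last k).ne]

lemma vand_expand {n : ℕ} (lam : Fin (n + 1) → ℂ) (i : Fin (n + 1)) :
    (∏ j, ∏ k ∈ Finset.Ioi j, (lam k - lam j)) =
      (-1) ^ ((i : ℕ) + n) * (∏ j : Fin n, (lam i - lam (i.succAbove j))) *
        ∏ j, ∏ k ∈ Finset.Ioi j, ((lam ∘ i.succAbove) k - (lam ∘ i.succAbove) j) := by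
  have hK : ∀ {n : ℕ} (lam : Fin n → ℂ), (KM (fun _ => 1) (fun _ => 0) lam).det =
      ∏ j, ∏ k ∈ Finset.Ioi j, (lam k - lam j) := by
    intro n lam
    rw [← Matrix.det_vandermonde]
    congr 1
    ext j k; simp [KM, Matrix.vandermonde_apply]
  rw [← hK, ← hK, KM_expand _ _ lam (∏ j : Fin n, (Polynomial.X - Polynomial.C (lam (i.succAbove j))))
    (Polynomial.monic_prod_of_monic _ _ fun j _ => Polynomial.monic_X_sub_C _)
    (by simp), Finset.sum_eq_single i]
  · simp [Polynomial.eval_prod]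
  · intro b _ hb
    obtain ⟨j, rfl⟩ := Fin.exists_succAbove_eq hb
    have : (∏ j : Fin n, (Polynomial.X - Polynomial.C (lam (i.succAbove j)))).eval (lam (i.succAbove j)) = 0 := by
      rw [Polynomial.eval_prod]
      exact Finset.prod_eq_zero (Finset.mem_univ j) (by simp)
    rw [this]; simp
  · simp

lemma main_ind {N : ℕ} (ν : Fin N → ℂ) (n : ℕ) : ∀ (m : ℕ) (_ : m + n = N) (lam : Fin n → ℂ)
    (_ : Function.Injective lam),
    zeta ν m (Finset.univ.image lam) * ∏ j, ∏ k ∈ Finset.Ioi j, (lam k - lam j) =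
      m.factorial * (KM (fun x => ∏ l, (x - ν l + 1)) (fun x => ∏ l, (x - ν l)) lam).det := by
  induction n with
  | zero =>
    intro m hm lam _
    obtain rfl : m = N := by omega
    simp [zeta, Phi, Spow_base]
  | succ n ih =>
    intro m hm lam hinj
    set s : Finset ℂ := Finset.univ.image (fun j : Fin n => lam j.succ) with hs
    have hT : Finset.univ.image lam = insert (lam 0) s := by
      ext x; simp [hs, Fin.exists_fin_succ, eq_comm]
    have hz : lam 0 ∉ s := by
      simp only [hs, Finset.mem_image, Finset.mem_univ, true_and, not_exists]
      intro j hj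
      exact Fin.succ_ne_zero j (hinj hj)
    have her : ∀ i, (Finset.univ.image lam).erase (lam i) = Finset.univ.image (lam ∘ i.succAbove) := by
      intro i
      ext x
      simp only [Finset.mem_erase, Finset.mem_image, Finset.mem_univ, true_and, Function.comp]
      constructor
      · rintro ⟨h1, j, rfl⟩
        have : j ≠ i := by rintro rfl; exact h1 rfl
        obtain ⟨k, rfl⟩ := Fin.exists_succAbove_eq this
        exact ⟨k, rfl⟩
      · rintro ⟨k, rfl⟩
        exact ⟨fun h => Fin.succAbove_ne i k (hinj h), _, rfl⟩
    have hrec := zeta_rec' ν m s (lam 0) hz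
    rw [← hT, Finset.sum_image (fun a _ b _ h => hinj h)] at hrec
    have hKe := KM_expand (fun x => ∏ l, (x - ν l + 1)) (fun x => ∏ l, (x - ν l)) lam
      (∏ j : Fin n, (Polynomial.X - Polynomial.C (1 + lam j.succ)))
      (Polynomial.monic_prod_of_monic _ _ fun j _ => Polynomial.monic_X_sub_C _) (by
        simp only [Polynomial.natDegree_finset_prod_X_sub_C_eq_card]; simp)
    have hps : ∀ x, ∏ y ∈ s, (x - (1 + y)) = (∏ j : Fin n, (Polynomial.X - Polynomial.C (1 + lam j.succ))).eval x := by
      intro x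
      rw [Polynomial.eval_prod, hs, Finset.prod_image]
      · simp only [Polynomial.eval_sub, Polynomial.eval_X, Polynomial.eval_C]
      · intro a _ b _ h
        exact Fin.succ_injective _ (hinj h)
    have hm1 : ((m : ℂ) + 1) ≠ 0 := Nat.cast_add_one_ne_zero m
    apply mul_left_cancel₀ hm1
    rw [← mul_assoc, hrec, hKe, Finset.sum_mul, Finset.mul_sum, Finset.mul_sum]
    refine Finset.sum_congr rfl fun i _ => ?_
    have hI := ih (m + 1) (by omega) (lam ∘ i.succAbove) (hinj.comp Fin.succAbove_right_injective)
    rw [vand_expand lam i, her i, hps, hps]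
    have hP : ∏ y ∈ Finset.univ.image (lam ∘ i.succAbove), (lam i - y) = ∏ j : Fin n, (lam i - lam (i.succAbove j)) := by
      rw [Finset.prod_image]
      · rfl
      · intro a _ b _ h
        exact (hinj.comp Fin.succAbove_right_injective) h
    have hP0 : ∏ j : Fin n, (lam i - lam (i.succAbove j)) ≠ 0 := Finset.prod_ne_zero_iff.2 fun j _ =>
      sub_ne_zero.2 fun h => Fin.succAbove_ne i j (hinj h).symm
    rw [hP]
    rw [Nat.factorial_succ] at hI
    push_cast at hI
    generalize (∏ j : Fin n, (Polynomial.X - Polynomial.C (1 + lam j.succ))) = p at *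
    generalize ∏ j : Fin n, (lam i - lam (i.succAbove j)) = P at *
    field_simp
    linear_combination ((∏ l, (lam i - ν l + 1)) * p.eval (lam i) -
      (∏ l, (lam i - ν l)) * p.eval (lam i + 1)) * hI

lemma Zfun_eq (N : ℕ) (ν lam : Fin N → ℂ) (hinj : Function.Injective lam) :
    Zfun N ν lam = zeta ν 0 (Finset.univ.image lam) := by
  have h1 : ∀ L : List (Fin N), (L.map fun j => Bop ν (lam j)).prod *ᵥ upVec N = Phi ν ((L.map lam : List ℂ) : Multiset ℂ) := by
    intro L
    induction L with
    | nil => simp [Phi]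
    | cons k L ih =>
      rw [List.map_cons, List.prod_cons, ← Matrix.mulVec_mulVec, ih, List.map_cons, ← Multiset.cons_coe]
      simp only [Phi, Multiset.foldr_cons]
  have h2 : (Finset.univ.image lam).val = (((List.finRange N).reverse.map lam : List ℂ) : Multiset ℂ) := by
    rw [Finset.image_val_of_injOn hinj.injOn, ← Multiset.map_coe, Multiset.coe_reverse]
    rfl
  rw [zeta, h2, ← h1, pow_zero, Matrix.one_mulVec, Zfun, upVec, basisVec, Matrix.mulVec_single_one]
  rfl

end SixVertex

open SixVertex in
/-- Kostov representation, rational case: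
`Z_N(λ) ⬝ ∏_{j<k} (λ_k - λ_j) = det[λ_j^{k-1} a(λ_j) - (λ_j+1)^{k-1} d(λ_j)]`, where
`a(λ) = ∏_l (λ - ν_l + 1)` and `d(λ) = ∏_l (λ - ν_l)`. -/
theorem Zfun_Kostov (N : ℕ) (hN : 1 ≤ N) (ν : Fin N → ℂ) (lam : Fin N → ℂ) :
    Zfun N ν lam * ∏ j, ∏ k ∈ Finset.Ioi j, (lam k - lam j) =
      Matrix.det (Matrix.of fun j k : Fin N =>
        lam j ^ (k : ℕ) * (∏ l, (lam j - ν l + 1)) -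
          (lam j + 1) ^ (k : ℕ) * ∏ l, (lam j - ν l)) := by
  by_cases hinj : Function.Injective lam
  · have h := main_ind ν N 0 (by omega) lam hinj
    rw [Zfun_eq N ν lam hinj, h]
    simp [KM]
  · simp only [Function.Injective, not_forall] at hinj
    obtain ⟨i, j, hij, hne⟩ := hinj
    rw [Matrix.det_zero_of_row_eq hne (by ext k; simp [hij]), ← Matrix.det_vandermonde,
      Matrix.det_zero_of_row_eq hne (by ext k; simp [Matrix.vandermonde_apply, hij]), mul_zero]
end

section
/- (Trigonometric Izergin–Korepin representation.) Let q ∈ ℂ with q ≠ 0 and q² ≠ 1, and let y_1,…,y_N ∈ ℂ be nonzero, pairwise distinct, and satisfy q² y_j ≠ y_k for all j ≠ k. Set ã(x) = ∏_{k=1}^N (q x − q^{−1} y_k) and d̃(x) = ∏_{k=1}^N (x − y_k). If P ∈ ℂ[x_1,…,x_N] satisfies the trigonometric DWBC conditions, then for all pairwise distinct x_1,…,x_N ∈ ℂ with x_j ≠ y_k and q x_j ≠ q^{−1} y_k for all j,k: P(x_1,…,x_N) · ∏_{1≤j<k≤N} (x_k − x_j) · ∏_{1≤j<k≤N} (y_j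 − y_k) = (∏_{j=1}^N ã(x_j) d̃(x_j)) · det[ (q − q^{−1}) / ((x_j − y_k)(q x_j − q^{−1} y_k)) ]_{j,k=1,…,N}. -/
open scoped BigOperators

namespace SixVertexTrig

/-- A polynomial `P ∈ ℂ[x_1,…,x_N]` satisfies the trigonometric DWBC conditions if it is
symmetric, of degree at most `N-1` in each variable, vanishes whenever two of its
arguments equal `y_j` and `q⁻² y_j` (for some `j`), and takes the value
`(q - q⁻¹)^N ∏_{j≠k} (q y_j - q⁻¹ y_k)` at `x = y`.  (Since `P` is required to be
symmetric, the vanishing condition is phrased via an arbitrary pair of distinct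
argument slots carrying the two values.) -/
def TrigCond (N : ℕ) (q : ℂ) (y : Fin N → ℂ) (P : MvPolynomial (Fin N) ℂ) : Prop :=
  P.IsSymmetric ∧
  (∀ j : Fin N, P.degreeOf j ≤ N - 1) ∧
  (∀ (j : Fin N) (x : Fin N → ℂ) (i₁ i₂ : Fin N), i₁ ≠ i₂ →
    x i₁ = y j → x i₂ = (q ^ 2)⁻¹ * y j → MvPolynomial.eval x P = 0) ∧
  MvPolynomial.eval y P =
    (q - q⁻¹) ^ N * ∏ j, ∏ k ∈ Finset.univ.erase j, (q * y j - q⁻¹ * y k)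

/-- The polynomial `p_i(x) = ∑_{j=1}^N p_{ij} x^{j-1}` of degree at most `N-1`,
determined by the row `i` of a coefficient matrix `p`. -/
noncomputable def pval {N : ℕ} (p : Matrix (Fin N) (Fin N) ℂ) (i : Fin N) (x : ℂ) : ℂ :=
  ∑ j, p i j * x ^ (j : ℕ)

/-- `ã(x) = ∏_{k=1}^N (q x - q⁻¹ y_k)`. -/
noncomputable def aTil (N : ℕ) (q : ℂ) (y : Fin N → ℂ) (x : ℂ) : ℂ :=
  ∏ k, (q * x - q⁻¹ * y k)

/-- `d̃(x) = ∏_{k=1}^N (x - y_k)`. -/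
noncomputable def dTil (N : ℕ) (y : Fin N → ℂ) (x : ℂ) : ℂ :=
  ∏ k, (x - y k)

end SixVertexTrig

namespace SixVertexTrig

open Polynomial Function

/-- `F` is polynomial of degree at most `d` in each variable separately. -/
def PolyIn {N : ℕ} (d : ℕ) (F : (Fin N → ℂ) → ℂ) : Prop :=
  ∀ x j, ∃ p : ℂ[X], p.natDegree ≤ d ∧ ∀ t, F (update x j t) = p.eval t

lemma PolyIn.mul {N d e : ℕ} {F G : (Fin N → ℂ) → ℂ} (hF : PolyIn d F) (hG : PolyIn e G) :
    PolyIn (d + e) (fun x => F x * G x) := by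
  intro x j
  obtain ⟨p, hp, hp'⟩ := hF x j
  obtain ⟨r, hr, hr'⟩ := hG x j
  refine ⟨p * r, natDegree_mul_le.trans (add_le_add hp hr), fun t => ?_⟩
  simp [hp', hr']

lemma PolyIn.mul_const {N d : ℕ} {F : (Fin N → ℂ) → ℂ} (hF : PolyIn d F) (c : ℂ) :
    PolyIn d (fun x => F x * c) := by
  intro x j
  obtain ⟨p, hp, hp'⟩ := hF x j
  refine ⟨p * C c, (natDegree_mul_C_le _ _).trans hp, fun t => ?_⟩
  simp [hp']

lemma PolyIn.sub {N d : ℕ} {F G : (Fin N → ℂ) → ℂ} (hF : PolyIn d F) (hG : PolyIn d G) :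
    PolyIn d (fun x => F x - G x) := by
  intro x j
  obtain ⟨p, hp, hp'⟩ := hF x j
  obtain ⟨r, hr, hr'⟩ := hG x j
  refine ⟨p - r, (natDegree_sub_le _ _).trans (max_le hp hr), fun t => ?_⟩
  simp [hp', hr']

lemma polyIn_det {N d : ℕ} (f : Fin N → ℂ[X]) (hf : ∀ k, (f k).natDegree ≤ d) :
    PolyIn d (fun x : Fin N → ℂ => Matrix.det (Matrix.of fun i k => (f k).eval (x i))) := by
  intro x j
  set A : Matrix (Fin N) (Fin N) ℂ := Matrix.of fun i k => (f k).eval (x i) with hA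
  refine ⟨∑ k, C (A.transpose.adjugate j k) * f k, ?_, fun t => ?_⟩
  · exact natDegree_sum_le_of_forall_le _ _ fun k _ => (natDegree_C_mul_le _ _).trans (hf k)
  · have h1 : (Matrix.of fun i k => (f k).eval (update x j t i)) =
        A.updateRow j (fun k => (f k).eval t) := by
      ext i k
      by_cases h : i = j
      · subst h; simp
      · simp [h, hA]
    simp only [h1]
    rw [← Matrix.cramer_transpose_apply, Matrix.cramer_eq_adjugate_mulVec]
    simp [Matrix.mulVec, dotProduct, eval_finsetSum]

lemma polyIn_eval {N d : ℕ} (P : MvPolynomial (Fin N) ℂ) (hP : ∀ j, P.degreeOf j ≤ d) :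
    PolyIn d (fun x => MvPolynomial.eval x P) := by
  intro x j
  refine ⟨∑ m ∈ P.support, C (P.coeff m * ∏ i ∈ Finset.univ.erase j, x i ^ m i) * X ^ m j,
    ?_, fun t => ?_⟩
  · refine natDegree_sum_le_of_forall_le _ _ fun m hm => (natDegree_C_mul_X_pow_le _ _).trans ?_
    exact (MvPolynomial.monomial_le_degreeOf j hm).trans (hP j)
  · simp only [MvPolynomial.eval_eq', eval_finsetSum]
    refine Finset.sum_congr rfl fun m _ => ?_
    rw [← Finset.mul_prod_erase Finset.univ _ (Finset.mem_univ j)]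
    have : ∏ i ∈ Finset.univ.erase j, update x j t i ^ m i =
        ∏ i ∈ Finset.univ.erase j, x i ^ m i := by
      refine Finset.prod_congr rfl fun i hi => ?_
      rw [update_of_ne (Finset.ne_of_mem_erase hi)]
    rw [this]
    simp only [update_self, eval_mul, eval_C, eval_pow, eval_X]
    ring

lemma PolyIn.zero_on {N d : ℕ} {F : (Fin N → ℂ) → ℂ} (hF : PolyIn d F) (x : Fin N → ℂ)
    (j : Fin N) (S : Finset ℂ) (hS : d < S.card) (h : ∀ s ∈ S, F (update x j s) = 0) (t : ℂ) :
    F (update x j t) = 0 := by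
  obtain ⟨p, hp, hp'⟩ := hF x j
  have : p = 0 := eq_zero_of_natDegree_lt_card_of_eval_eq_zero' p S
    (fun s hs => by rw [← hp']; exact h s hs) (lt_of_le_of_lt hp hS)
  rw [hp', this]; simp

lemma PolyIn.eq_zero {N d : ℕ} {F : (Fin N → ℂ) → ℂ} (hF : PolyIn d F) (S : Finset ℂ)
    (hS : d < S.card) (h : ∀ x, (∀ i, x i ∈ S) → F x = 0) (x : Fin N → ℂ) : F x = 0 := by
  have key : ∀ T : Finset (Fin N), ∀ x : Fin N → ℂ, (∀ i, i ∉ T → x i ∈ S) → F x = 0 := by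
    intro T
    induction T using Finset.induction_on with
    | empty => exact fun x hx => h x fun i => hx i (by simp)
    | insert j T hj ih =>
      intro x hx
      have := hF.zero_on x j S hS (fun s hs => ih _ fun i hi => ?_) (x j)
      · simpa using this
      · by_cases hij : i = j
        · subst hij; simpa using hs
        · rw [update_of_ne hij]; exact hx i (by simp [hij, hi])
  exact key Finset.univ x (by simp)

/-- the interpolation points -/
noncomputable def pt {N : ℕ} (q : ℂ) (y : Fin N → ℂ) (a : Fin N × Bool) : ℂ :=
  if a.2 then y a.1 else (q ^ 2)⁻¹ * y a.1

lemma pt_injective {N : ℕ} {q : ℂ} (hq : q ≠ 0) (hq2 : q ^ 2 ≠ 1)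
    {y : Fin N → ℂ} (hy0 : ∀ j, y j ≠ 0) (hy : Function.Injective y)
    (hyq : ∀ j k : Fin N, j ≠ k → q ^ 2 * y j ≠ y k) : Injective (pt q y) := by
  have hq' : q ^ 2 ≠ 0 := pow_ne_zero _ hq
  have key : ∀ j k, y j ≠ (q ^ 2)⁻¹ * y k := by
    intro j k h
    have h2 : q ^ 2 * y j = y k := by rw [h]; field_simp
    by_cases hjk : j = k
    · subst hjk
      exact hq2 (mul_right_cancel₀ (hy0 j) (by rw [h2, one_mul]))
    · exact hyq j k hjk h2
  rintro ⟨j, b⟩ ⟨k, c⟩ h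
  cases b <;> cases c <;> simp only [pt] at h
  · have := hy (mul_left_cancel₀ (inv_ne_zero hq') (by simpa using h)); simp [this]
  · exact absurd (by simpa using h.symm) (key k j)
  · exact absurd (by simpa using h) (key j k)
  · have := hy (by simpa using h); simp [this]

/-- Abstract vanishing: degree at most `2N-2` in each variable, plus vanishing on
degenerate grid points and on permutations of `y`. -/
lemma vanish {N : ℕ} (hN : 1 ≤ N) {q : ℂ} {y : Fin N → ℂ} (hw : Injective (pt q y))
    {F : (Fin N → ℂ) → ℂ} (hF : PolyIn (2 * N - 2) F)
    (h1 : ∀ g : Fin N → Fin N × Bool, ¬ Injective (fun i => (g i).1) →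
      F (fun i => pt q y (g i)) = 0)
    (h2 : ∀ σ : Equiv.Perm (Fin N), F (fun i => y (σ i)) = 0) (x : Fin N → ℂ) : F x = 0 := by
  have hgrid : ∀ n : ℕ, ∀ g : Fin N → Fin N × Bool,
      (Finset.univ.filter fun i => (g i).2 = false).card = n →
      F (fun i => pt q y (g i)) = 0 := by
    intro n
    induction n with
    | zero =>
      intro g hg
      by_cases hi : Injective (fun i => (g i).1)
      · have hb := Finite.injective_iff_bijective.1 hi
        have := h2 (Equiv.ofBijective _ hb)
        convert this using 2
        funext i
        have hgi : (g i).2 = true := by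
          have := Finset.card_eq_zero.1 hg
          rw [Finset.filter_eq_empty_iff] at this
          simpa using this (Finset.mem_univ i)
        simp [pt, hgi]
      · exact h1 g hi
    | succ n ih =>
      intro g hg
      by_cases hi : Injective (fun i => (g i).1)
      swap
      · exact h1 g hi
      have hb := Finite.injective_iff_bijective.1 hi
      obtain ⟨j, hj⟩ : (Finset.univ.filter fun i => (g i).2 = false).Nonempty := by
        rw [← Finset.card_pos, hg]; omega
      have hjf : (g j).2 = false := by simpa using hj
      have hupd : ∀ a, update (fun i => pt q y (g i)) j (pt q y a) =
          fun i => pt q y (update g j a i) := by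
        intro a; funext i
        by_cases hij : i = j
        · subst hij; simp
        · simp [hij]
      have := hF.zero_on (fun i => pt q y (g i)) j
        ((Finset.univ.erase (g j)).image (pt q y)) ?_ ?_ (pt q y (g j))
      · simpa using this
      · rw [Finset.card_image_of_injective _ hw, Finset.card_erase_of_mem (Finset.mem_univ _)]
        simp only [Finset.card_univ, Fintype.card_prod, Fintype.card_fin, Fintype.card_bool]
        omega
      · intro s hs
        obtain ⟨a, ha, rfl⟩ := Finset.mem_image.1 hs
        have ha' : a ≠ g j := Finset.ne_of_mem_erase ha
        rw [hupd]
        by_cases hag : a.1 = (g j).1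
        · have ha2 : a.2 = true := by
            by_contra hc
            apply ha'
            ext
            · rw [hag]
            · rw [hjf]; simpa using hc
          apply ih
          have : (Finset.univ.filter fun i => (update g j a i).2 = false) =
              (Finset.univ.filter fun i => (g i).2 = false).erase j := by
            ext i
            by_cases hij : i = j
            · subst hij; simp [ha2]
            · simp [hij]
          rw [this, Finset.card_erase_of_mem hj, hg]; rfl
        · apply h1
          intro hinj
          obtain ⟨i, hi'⟩ := hb.2 a.1
          have hij : i ≠ j := by
            rintro rfl; exact hag hi'.symm
          apply hij
          apply hinj
          simpa [hij] using hi'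
  refine hF.eq_zero (Finset.univ.image (pt q y)) ?_ ?_ x
  · rw [Finset.card_image_of_injective _ hw]
    simp only [Finset.card_univ, Fintype.card_prod, Fintype.card_fin, Fintype.card_bool]
    omega
  · intro x hx
    have : ∀ i, ∃ a, pt q y a = x i := fun i => by simpa using hx i
    choose g hg using this
    have := hgrid _ g rfl
    simpa [hg] using this

/-- the column polynomials of the cleared Izergin determinant -/
noncomputable def col {N : ℕ} (q : ℂ) (y : Fin N → ℂ) (k : Fin N) : ℂ[X] :=
  C (q - q⁻¹) * ∏ l ∈ Finset.univ.erase k, ((X - C (y l)) * (C q * X - C (q⁻¹ * y l)))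

lemma col_eval {N : ℕ} (q : ℂ) (y : Fin N → ℂ) (k : Fin N) (t : ℂ) :
    (col q y k).eval t =
      (q - q⁻¹) * ∏ l ∈ Finset.univ.erase k, ((t - y l) * (q * t - q⁻¹ * y l)) := by
  simp [col, eval_prod]

lemma col_natDegree {N : ℕ} (q : ℂ) (y : Fin N → ℂ) (k : Fin N) :
    (col q y k).natDegree ≤ 2 * N - 2 := by
  refine (natDegree_C_mul_le _ _).trans ((natDegree_prod_le _ _).trans ?_)
  refine (Finset.sum_le_card_nsmul _ _ 2 fun l _ => ?_).trans ?_
  · compute_degree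
  · rw [Finset.card_erase_of_mem (Finset.mem_univ _)]
    simp; omega

lemma col_pt {N : ℕ} {q : ℂ} (hq : q ≠ 0) (y : Fin N → ℂ) (k : Fin N) (a : Fin N × Bool)
    (h : a.1 ≠ k) : (col q y k).eval (pt q y a) = 0 := by
  rw [col_eval]
  apply mul_eq_zero_of_right
  apply Finset.prod_eq_zero (Finset.mem_erase.2 ⟨h, Finset.mem_univ _⟩)
  rcases a with ⟨j, b⟩
  cases b
  · apply mul_eq_zero_of_right
    simp only [pt]
    simp
    field_simp
    simp
  · simp [pt]

lemma prod_erase_split {N : ℕ} (f : Fin N → Fin N → ℂ) :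
    ∏ j, ∏ k ∈ Finset.univ.erase j, f j k =
      (∏ j, ∏ k ∈ Finset.Ioi j, f k j) * ∏ j, ∏ k ∈ Finset.Ioi j, f j k := by
  have h : ∀ j : Fin N, ∏ k ∈ Finset.univ.erase j, f j k =
      (∏ k ∈ Finset.Iio j, f j k) * ∏ k ∈ Finset.Ioi j, f j k := by
    intro j
    rw [← Finset.prod_union]
    · congr 1
      ext k
      simp [lt_or_lt_iff_ne]
    · rw [Finset.disjoint_left]
      intro a ha hb
      simp at ha hb
      exact absurd ha (not_lt.2 hb.le)
  simp_rw [h, Finset.prod_mul_distrib]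
  congr 1
  apply Finset.prod_comm'
  simp

/-- the difference of the two sides of the cleared identity -/
noncomputable def diffFun {N : ℕ} (q : ℂ) (y : Fin N → ℂ) (P : MvPolynomial (Fin N) ℂ)
    (x : Fin N → ℂ) : ℂ :=
  MvPolynomial.eval x P * Matrix.det (Matrix.of fun i k : Fin N => (X ^ (k : ℕ) : ℂ[X]).eval (x i)) *
    (∏ j, ∏ k ∈ Finset.Ioi j, (y j - y k)) -
  Matrix.det (Matrix.of fun i k : Fin N => (col q y k).eval (x i))

lemma vand {N : ℕ} (x : Fin N → ℂ) :
    Matrix.det (Matrix.of fun i k : Fin N => (X ^ (k : ℕ) : ℂ[X]).eval (x i)) =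
      ∏ j, ∏ k ∈ Finset.Ioi j, (x k - x j) := by
  rw [← Matrix.det_vandermonde]
  congr 1
  ext i k
  simp [Matrix.vandermonde]

lemma diffFun_polyIn {N : ℕ} (hN : 1 ≤ N) (q : ℂ) (y : Fin N → ℂ) (P : MvPolynomial (Fin N) ℂ)
    (hP : ∀ j : Fin N, P.degreeOf j ≤ N - 1) : PolyIn (2 * N - 2) (diffFun q y P) := by
  have h1 := polyIn_eval P hP
  have h2 := polyIn_det (d := N - 1) (fun k : Fin N => (X ^ (k : ℕ) : ℂ[X]))
    (fun k => by rw [natDegree_X_pow]; omega)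
  have h3 := polyIn_det (fun k : Fin N => col q y k) (fun k => col_natDegree q y k)
  have h12 := h1.mul h2
  rw [show N - 1 + (N - 1) = 2 * N - 2 by omega] at h12
  exact (h12.mul_const _).sub h3

lemma diffFun_perm {N : ℕ} (q : ℂ) (y : Fin N → ℂ) (P : MvPolynomial (Fin N) ℂ)
    (hP : P.IsSymmetric) (σ : Equiv.Perm (Fin N)) (x : Fin N → ℂ) :
    diffFun q y P (fun i => x (σ i)) = (Equiv.Perm.sign σ : ℤ) * diffFun q y P x := by
  have hd : ∀ f : Fin N → ℂ[X], Matrix.det (Matrix.of fun i k : Fin N => (f k).eval (x (σ i))) =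
      (Equiv.Perm.sign σ : ℤ) * Matrix.det (Matrix.of fun i k : Fin N => (f k).eval (x i)) :=
    fun f => Matrix.det_permute σ (Matrix.of fun i k : Fin N => (f k).eval (x i))
  have he : MvPolynomial.eval (fun i => x (σ i)) P = MvPolynomial.eval x P := by
    conv_rhs => rw [← hP σ]
    rw [MvPolynomial.eval_rename]
    rfl
  unfold diffFun
  rw [hd (fun k => X ^ (k : ℕ)), hd (fun k => col q y k), he]
  ring

lemma diffFun_zero {N : ℕ} (hN : 1 ≤ N) {q : ℂ} (hq : q ≠ 0) (hq2 : q ^ 2 ≠ 1)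
    {y : Fin N → ℂ} (hy0 : ∀ j, y j ≠ 0) (hy : Function.Injective y)
    (hyq : ∀ j k : Fin N, j ≠ k → q ^ 2 * y j ≠ y k)
    {P : MvPolynomial (Fin N) ℂ} (hP : TrigCond N q y P) (x : Fin N → ℂ) :
    diffFun q y P x = 0 := by
  obtain ⟨hs, hdeg, hv, hn⟩ := hP
  refine vanish hN (pt_injective hq hq2 hy0 hy hyq) (diffFun_polyIn hN q y P hdeg) ?_ ?_ x
  · intro g hg
    obtain ⟨i, j, hij, hne⟩ : ∃ i j, (g i).1 = (g j).1 ∧ i ≠ j := by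
      simpa [Injective] using hg
    have hdet : Matrix.det (Matrix.of fun i k : Fin N => (col q y k).eval (pt q y (g i))) = 0 := by
      rw [Matrix.det_apply]
      refine Finset.sum_eq_zero fun σ _ => ?_
      apply smul_eq_zero_of_right
      obtain ⟨l, hl⟩ : ∃ l, (g (σ l)).1 ≠ l := by
        by_contra hc
        push Not at hc
        have ha := hc (σ.symm i)
        have hb := hc (σ.symm j)
        simp only [Equiv.apply_symm_apply] at ha hb
        exact hne (σ.symm.injective (by rw [← ha, ← hb, hij]))
      exact Finset.prod_eq_zero (Finset.mem_univ l) (col_pt hq y l _ hl)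
    have hpv : MvPolynomial.eval (fun i => pt q y (g i)) P *
        Matrix.det (Matrix.of fun i k : Fin N =>
          (X ^ (k : ℕ) : ℂ[X]).eval (pt q y (g i))) = 0 := by
      by_cases hgg : g i = g j
      · apply mul_eq_zero_of_right
        apply Matrix.det_zero_of_row_eq hne
        funext k
        simp [hgg]
      · apply mul_eq_zero_of_left
        have hb : (g i).2 ≠ (g j).2 := fun h => hgg (Prod.ext hij h)
        cases hi : (g i).2 <;> cases hj : (g j).2
        · simp [hi, hj] at hb
        · exact hv (g j).1 _ j i hne.symm (by simp [pt, hj]) (by simp [pt, hi, hij])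
        · exact hv (g i).1 _ i j hne (by simp [pt, hi]) (by simp [pt, hj, hij])
        · simp [hi, hj] at hb
    unfold diffFun
    rw [hdet, hpv]
    simp
  · intro σ
    rw [diffFun_perm q y P hs]
    apply mul_eq_zero_of_right
    have hdet : (Matrix.of fun i k : Fin N => (col q y k).eval (y i)) =
        Matrix.diagonal fun i => (col q y i).eval (y i) := by
      ext i k
      by_cases h : i = k
      · subst h; simp
      · have := col_pt hq y k (i, true) h
        simp only [pt, if_true] at this
        simp [h, this]
    unfold diffFun
    rw [hdet, Matrix.det_diagonal, vand, hn]
    simp only [col_eval, Finset.prod_mul_distrib]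
    rw [prod_erase_split (fun j l => y j - y l)]
    simp only [Finset.prod_const, Finset.card_univ, Fintype.card_fin]
    ring

end SixVertexTrig

open SixVertexTrig in
/-- trigonometric Izergin–Korepin representation: if `P` satisfies the
trigonometric DWBC conditions, then for pairwise distinct `x_1,…,x_N` with `x_j ≠ y_k`
and `q x_j ≠ q⁻¹ y_k`:
`P(x) ⬝ ∏_{j<k}(x_k - x_j) ⬝ ∏_{j<k}(y_j - y_k)
  = (∏_j ã(x_j) d̃(x_j)) ⬝ det[(q - q⁻¹)/((x_j - y_k)(q x_j - q⁻¹ y_k))]`. -/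
theorem trig_IK (N : ℕ) (hN : 1 ≤ N) (q : ℂ) (hq : q ≠ 0) (hq2 : q ^ 2 ≠ 1)
    (y : Fin N → ℂ) (hy0 : ∀ j, y j ≠ 0) (hy : Function.Injective y)
    (hyq : ∀ j k : Fin N, j ≠ k → q ^ 2 * y j ≠ y k)
    (P : MvPolynomial (Fin N) ℂ) (hP : TrigCond N q y P)
    (x : Fin N → ℂ) (hx : Function.Injective x)
    (hxy : ∀ j k : Fin N, x j ≠ y k)
    (hqxy : ∀ j k : Fin N, q * x j ≠ q⁻¹ * y k) :
    MvPolynomial.eval x P * (∏ j, ∏ k ∈ Finset.Ioi j, (x k - x j)) *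
        (∏ j, ∏ k ∈ Finset.Ioi j, (y j - y k)) =
      (∏ j, aTil N q y (x j) * dTil N y (x j)) *
        Matrix.det (Matrix.of fun j k : Fin N =>
          (q - q⁻¹) / ((x j - y k) * (q * x j - q⁻¹ * y k))) := by
  have h := diffFun_zero hN hq hq2 hy0 hy hyq hP x
  unfold diffFun at h
  rw [vand, sub_eq_zero] at h
  rw [h, ← Matrix.det_mul_column]
  congr 1
  ext j k
  rw [Matrix.of_apply, Matrix.of_apply, Matrix.of_apply, col_eval, aTil, dTil,
    ← Finset.prod_mul_distrib, ← Finset.mul_prod_erase Finset.univ _ (Finset.mem_univ k)]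
  have e1 : x j - y k ≠ 0 := sub_ne_zero.2 (hxy j k)
  have e2 : q * x j - q⁻¹ * y k ≠ 0 := sub_ne_zero.2 (hqxy j k)
  have e3 : ∏ l ∈ Finset.univ.erase k, ((x j - y l) * (q * x j - q⁻¹ * y l)) =
      ∏ l ∈ Finset.univ.erase k, ((q * x j - q⁻¹ * y l) * (x j - y l)) :=
    Finset.prod_congr rfl fun l _ => mul_comm _ _
  rw [e3]
  generalize ∏ l ∈ Finset.univ.erase k, ((q * x j - q⁻¹ * y l) * (x j - y l)) = R
  generalize q * x j - q⁻¹ * y k = u at *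
  generalize q - q⁻¹ = v at *
  field_simp
end
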